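/- For every integer k ≥ 3, Ũ_4(3k) ≤ 5k + 10 + Ũ_2(k) + Ũ_4(k); in particular, Ũ_4(3k) ≤ 11k − 3 for every integer k ≥ 3. -/

import Mathlib

open scoped BigOperators

/-- A lazy transposition on `n` positions, encoded as a triple `(a, b, p)`. -/
abbrev LazyT (n : ℕ) := Fin n × Fin n × ℝ

/-- The triple `(a, b, p)` is a valid lazy transposition: `a ≠ b` and `p ∈ [0,1]`. -/
def LazyT.Valid {n : ℕ} (e : LazyT n) : Prop :=
  e.1 ≠ e.2.1 ∧ 0 ≤ e.2.2 ∧ e.2.2 ≤ 1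

/-- A star transposition: its first coordinate is position `1` (index `0` in `Fin n`). -/
def LazyT.IsStar {n : ℕ} (e : LazyT n) : Prop := (e.1 : ℕ) = 0

/-- `permDist L σ` is the probability that the composition of the independent lazy
transpositions in `L` (applied in order) equals the permutation `σ`. -/
noncomputable def permDist {n : ℕ} : List (LazyT n) → Equiv.Perm (Fin n) → ℝ
  | [], σ => if σ = 1 then 1 else 0
  | e :: L, σ =>
      e.2.2 * permDist L (σ * Equiv.swap e.1 e.2.1) + (1 - e.2.2) * permDist L σ

/-- `L` is a transposition shuffle on `n` points: all entries are valid lazy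
transpositions and the composition is uniformly distributed on `Perm (Fin n)`. -/
def IsShuffle {n : ℕ} (L : List (LazyT n)) : Prop :=
  (∀ e ∈ L, e.Valid) ∧
  ∀ σ : Equiv.Perm (Fin n), permDist L σ = 1 / (n.factorial : ℝ)

/-- `U n` is the minimum length of a transposition shuffle on `n` points. -/
noncomputable def U (n : ℕ) : ℕ :=
  sInf { ℓ : ℕ | ∃ L : List (LazyT n), L.length = ℓ ∧ IsShuffle L }

/-- The probability that, after applying the lazy transpositions in `L`, the `t`
labelled counters starting in positions `1, …, t` end up placed according to the
map `f` (counter `i` in position `f i`). -/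
noncomputable def placeProb {n t : ℕ} (ht : t ≤ n) (L : List (LazyT n))
    (f : Fin t → Fin n) : ℝ :=
  ∑ σ : Equiv.Perm (Fin n),
    if ∀ i : Fin t, σ (Fin.castLE ht i) = f i then permDist L σ else 0

/-- `L` is a `(t,n)`-shuffle: all entries are valid and the final placement of the
`t` counters is uniform over all `n!/(n-t)!` injections. -/
def IsTShuffle {n t : ℕ} (ht : t ≤ n) (L : List (LazyT n)) : Prop :=
  (∀ e ∈ L, e.Valid) ∧
  ∀ f : Fin t → Fin n, Function.Injective f →
    placeProb ht L f = ((n - t).factorial : ℝ) / (n.factorial : ℝ)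

/-- `Ut t n` is the minimum length of a `(t,n)`-shuffle. -/
noncomputable def Ut (t n : ℕ) : ℕ :=
  sInf { ℓ : ℕ | ∃ (ht : t ≤ n) (L : List (LazyT n)), L.length = ℓ ∧ IsTShuffle ht L }

/-- The probability that after applying `L` the set of positions occupied by the
`t` (indistinguishable) counters starting in positions `1, …, t` is exactly `S`. -/
noncomputable def occProb {n t : ℕ} (ht : t ≤ n) (L : List (LazyT n))
    (S : Finset (Fin n)) : ℝ :=
  ∑ σ : Equiv.Perm (Fin n),
    if Finset.image (fun i : Fin t => σ (Fin.castLE ht i)) Finset.univ = S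
    then permDist L σ else 0

/-- `L` shuffles `t` indistinguishable counters over `n` positions: all entries are
valid and the occupied set is uniform over all `n.choose t` subsets of size `t`. -/
def IsIndShuffle {n t : ℕ} (ht : t ≤ n) (L : List (LazyT n)) : Prop :=
  (∀ e ∈ L, e.Valid) ∧
  ∀ S : Finset (Fin n), S.card = t → occProb ht L S = 1 / (n.choose t : ℝ)

/-- `Uhat t n` is the minimum length of a sequence of lazy transpositions shuffling
`t` indistinguishable counters uniformly over `n` positions. -/
noncomputable def Uhat (t n : ℕ) : ℕ :=
  sInf { ℓ : ℕ | ∃ (ht : t ≤ n) (L : List (LazyT n)), L.length = ℓ ∧ IsIndShuffle ht L }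

/-- `Ustar n` is the minimum length of a transposition shuffle on `n` points all of
whose lazy transpositions are star transpositions. -/
noncomputable def Ustar (n : ℕ) : ℕ :=
  sInf { ℓ : ℕ | ∃ L : List (LazyT n), L.length = ℓ ∧ IsShuffle L ∧ ∀ e ∈ L, e.IsStar }

/-- `Utstar t n` is the minimum length of a `(t,n)`-shuffle all of whose lazy
transpositions are star transpositions. -/
noncomputable def Utstar (t n : ℕ) : ℕ :=
  sInf { ℓ : ℕ | ∃ (ht : t ≤ n) (L : List (LazyT n)),
    L.length = ℓ ∧ IsTShuffle ht L ∧ ∀ e ∈ L, e.IsStar }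


open Equiv

set_option linter.unusedSectionVars false

section Basics

/-- Expected value of `F` after running the list `L` from state `x`. -/
noncomputable def EV {P X : Type*} [DecidableEq P] [MulAction (Perm P) X] :
    List (P × P × ℝ) → (X → ℝ) → X → ℝ
  | [], F, x => F x
  | e :: L, F, x => e.2.2 * EV L F (swap e.1 e.2.1 • x) + (1 - e.2.2) * EV L F x

/-- validity of a lazy transposition on general position types -/
def VV {P : Type*} (e : P × P × ℝ) : Prop := e.1 ≠ e.2.1 ∧ 0 ≤ e.2.2 ∧ e.2.2 ≤ 1

variable {P X : Type*} [DecidableEq P] [MulAction (Perm P) X]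

lemma EV_append (L M : List (P × P × ℝ)) (F : X → ℝ) (x : X) :
    EV (L ++ M) F x = EV L (EV M F) x := by
  induction L generalizing x with
  | nil => rfl
  | cons e L ih => simp [EV, ih]

lemma EV_smul (L : List (P × P × ℝ)) (F : X → ℝ) (x : X) (σ : Perm P) :
    EV L (fun τ : Perm P => F (τ • x)) σ = EV L F (σ • x) := by
  induction L generalizing σ with
  | nil => rfl
  | cons e L ih => simp [EV, ih, mul_smul]

lemma EV_congr {Y : Type*} [MulAction (Perm P) Y]
    (L : List (P × P × ℝ)) (F : X → ℝ) (G : Y → ℝ) (x : X) (y : Y)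
    (h : ∀ ρ : Perm P, F (ρ • x) = G (ρ • y)) : EV L F x = EV L G y := by
  induction L generalizing x y with
  | nil => simpa [EV] using h 1
  | cons e L ih =>
    simp only [EV]
    rw [ih x y h, ih (swap e.1 e.2.1 • x) (swap e.1 e.2.1 • y)
      (fun ρ => by simpa [mul_smul] using h (ρ * swap e.1 e.2.1))]

lemma EV_sum {κ : Type*} (s : Finset κ) (L : List (P × P × ℝ)) (F : κ → X → ℝ) (x : X) :
    EV L (fun x => ∑ i ∈ s, F i x) x = ∑ i ∈ s, EV L (F i) x := by
  induction L generalizing x with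
  | nil => rfl
  | cons e L ih => simp [EV, ih, Finset.mul_sum, Finset.sum_add_distrib]

lemma EV_mul (L : List (P × P × ℝ)) (a : ℝ) (F : X → ℝ) (x : X) :
    EV L (fun x => a * F x) x = a * EV L F x := by
  induction L generalizing x with
  | nil => rfl
  | cons e L ih => simp [EV, ih]; ring

/-- lifting along a group homomorphism -/
lemma EV_lift {Q : Type*} [DecidableEq Q] (Θ : Perm Q →* Perm P) (j : Q → P)
    (hj : ∀ a b, Θ (swap a b) = swap (j a) (j b)) (L : List (Q × Q × ℝ))
    (F : X → ℝ) (x : X) (σ : Perm Q) :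
    EV (L.map (fun e => (j e.1, j e.2.1, e.2.2))) F (Θ σ • x)
      = EV L (fun τ : Perm Q => F (Θ τ • x)) σ := by
  induction L generalizing σ with
  | nil => rfl
  | cons e L ih =>
    simp only [EV, List.map_cons]
    rw [ih, ← hj, ← mul_smul, ← map_mul, ih]
    rfl

/-- `L` shuffles the points of `s`. -/
def Sh {P ι : Type*} [DecidableEq P] [Fintype P] (L : List (P × P × ℝ)) (s : ι → P) : Prop :=
  ∀ F : Perm P → ℝ, (∀ σ τ : Perm P, (∀ i, σ (s i) = τ (s i)) → F σ = F τ) →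
    EV L F 1 = (1 / ((Fintype.card P).factorial : ℝ)) * ∑ σ, F σ

lemma EV_sum_smul {G : Type*} [Fintype G] [Group G] (Θ : G →* Perm P)
    (L : List (P × P × ℝ)) (hL : ∀ e ∈ L, ∃ g, Θ g = swap e.1 e.2.1) (F : X → ℝ) (x : X) :
    ∑ g, EV L F (Θ g • x) = ∑ g, F (Θ g • x) := by
  induction L with
  | nil => rfl
  | cons e L ih =>
    obtain ⟨g0, hg⟩ := hL e (by simp)
    have ih := ih (fun e he => hL e (by simp [he]))
    simp only [EV, Finset.sum_add_distrib, ← Finset.mul_sum]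
    rw [ih, ← hg]
    have : ∑ g, EV L F (Θ g0 • Θ g • x) = ∑ g, EV L F (Θ g • x) := by
      simp only [← mul_smul, ← map_mul]
      exact Fintype.sum_equiv (Equiv.mulLeft g0) _ _ (fun _ => rfl)
    rw [this, ih]; ring

/-- spread the content of `a` over `cs`, probability `v` each -/
noncomputable def spread (a : P) : List P → ℝ → List (P × P × ℝ)
  | [], _ => []
  | c :: cs, v => (a, c, v) :: spread a cs (v / (1 - v))

lemma spread_length (a : P) (cs : List P) (v : ℝ) : (spread a cs v).length = cs.length := by
  induction cs generalizing v with
  | nil => rfl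
  | cons c cs ih => simp [spread, ih]

lemma spread_valid (a : P) (cs : List P) (v : ℝ) (ha : a ∉ cs) (hv : 0 ≤ v)
    (hm : cs.length * v ≤ 1) : ∀ e ∈ spread a cs v, VV e ∧ e.1 = a := by
  induction cs generalizing v with
  | nil => simp [spread]
  | cons c cs ih =>
    simp only [List.mem_cons, not_or] at ha
    push_cast [List.length_cons] at hm
    have hn : (0:ℝ) ≤ cs.length * v := by positivity
    have hv1 : v ≤ 1 := by nlinarith
    intro e he
    simp only [spread, List.mem_cons] at he
    rcases he with rfl | he
    · exact ⟨⟨ha.1, hv, hv1⟩, rfl⟩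
    · refine ih (v / (1 - v)) ha.2 (div_nonneg hv (by linarith)) ?_ e he
      rcases eq_or_lt_of_le hv1 with h | h
      · simp [h]
      · rw [← mul_div_assoc, div_le_one (by linarith)]; linarith

lemma spread_fix (a : P) (cs : List P) (v : ℝ) (G : X → ℝ) (x : X)
    (h : ∀ c ∈ cs, swap a c • x = x) : EV (spread a cs v) G x = G x := by
  induction cs generalizing v with
  | nil => rfl
  | cons c cs ih =>
    simp only [spread, EV]
    rw [h c (by simp), ih _ (fun c hc => h c (by simp [hc]))]; ring

lemma spread_eval (a : P) (cs : List P) (v : ℝ) (G : X → ℝ) (x : X) (hn : cs.Nodup)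
    (hv : 0 ≤ v) (hm : cs.length * v ≤ 1)
    (h : ∀ c ∈ cs, ∀ c' ∈ cs, c ≠ c' → swap a c' • swap a c • x = swap a c • x) :
    EV (spread a cs v) G x
      = (1 - cs.length * v) * G x + v * (cs.map (fun c => G (swap a c • x))).sum := by
  induction cs generalizing v with
  | nil => simp [spread, EV]
  | cons c cs ih =>
    push_cast [List.length_cons] at hm
    have hn0 : (0:ℝ) ≤ cs.length * v := by positivity
    have hv1 : v ≤ 1 := by nlinarith
    rw [List.nodup_cons] at hn
    simp only [spread, EV, List.map_cons, List.sum_cons, List.length_cons]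
    rw [spread_fix]
    · rcases eq_or_lt_of_le hv1 with h1 | h1
      · subst h1
        have : (cs.length : ℝ) ≤ 0 := by linarith
        have : cs.length = 0 := by exact_mod_cast le_antisymm this (by positivity)
        have : cs = [] := List.length_eq_zero_iff.mp this
        subst this; simp
      · have h1' : (1 - v) ≠ 0 := by linarith
        rw [ih (v / (1 - v)) hn.2 (div_nonneg hv (by linarith))
          (by rw [← mul_div_assoc, div_le_one (by linarith)]; linarith)
          (fun c hc c' hc' => h c (by simp [hc]) c' (by simp [hc']))]
        push_cast
        field_simp
        ring
    · intro c' hc'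
      exact h c (by simp) c' (by simp [hc']) (by rintro rfl; exact hn.1 hc')

end Basics

section Orbits

lemma exists_perm_ext {ι Q : Type*} [Finite Q] (c c' : ι → Q) (hc : Function.Injective c)
    (hc' : Function.Injective c') : ∃ σ : Perm Q, ∀ i, σ (c i) = c' i := by
  classical
  let e : {x // x ∈ Set.range c} ≃ {x // x ∈ Set.range c'} :=
    (Equiv.ofInjective c hc).symm.trans (Equiv.ofInjective c' hc')
  refine ⟨e.extendSubtype, fun i => ?_⟩
  rw [Equiv.extendSubtype_apply_of_mem e (c i) ⟨i, rfl⟩]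
  have : (⟨c i, ⟨i, rfl⟩⟩ : {x // x ∈ Set.range c}) = Equiv.ofInjective c hc i := rfl
  rw [this]
  simp [e]

/-- `c` is injective on the fibres of `r` -/
def Blk {ι R Q : Type*} (r : ι → R) (c : ι → Q) : Prop := ∀ i j, r i = r j → c i = c j → i = j

lemma exists_blk_ext {ι R Q : Type*} [Finite Q] (r : ι → R) (c c' : ι → Q) (hc : Blk r c)
    (hc' : Blk r c') : ∃ η : R → Perm Q, ∀ i, η (r i) (c i) = c' i := by
  have : ∀ x : R, ∃ σ : Perm Q, ∀ i : {i // r i = x}, σ (c i) = c' i := fun x =>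
    exists_perm_ext (fun i : {i // r i = x} => c i) (fun i : {i // r i = x} => c' i)
      (fun i j h => Subtype.ext (hc i j (by rw [i.2, j.2]) h))
      (fun i j h => Subtype.ext (hc' i j (by rw [i.2, j.2]) h))
  choose η hη using this
  exact ⟨η, fun i => hη (r i) ⟨i, rfl⟩⟩

lemma block_avg {ι R Q : Type*} [Fintype ι] [Fintype R] [Fintype Q]
    [DecidableEq ι] [DecidableEq R] [DecidableEq Q] (r : ι → R)
    [DecidablePred (fun c : ι → Q => Blk r c)]
    (f : (ι → Q) → ℝ) (c0 : ι → Q) (hc0 : Blk r c0) :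
    (((Finset.univ.filter (fun c : ι → Q => Blk r c)).card : ℕ) : ℝ)
        * ∑ η : R → Perm Q, f (fun i => η (r i) (c0 i))
      = (Fintype.card (R → Perm Q) : ℝ)
        * ∑ c ∈ Finset.univ.filter (fun c : ι → Q => Blk r c), f c := by
  set S := Finset.univ.filter (fun c : ι → Q => Blk r c) with hS
  have h1 : ∀ c ∈ S, ∑ η : R → Perm Q, f (fun i => η (r i) (c i))
      = ∑ η : R → Perm Q, f (fun i => η (r i) (c0 i)) := by
    intro c hc
    rw [hS, Finset.mem_filter] at hc
    obtain ⟨η0, h0⟩ := exists_blk_ext r c0 c hc0 hc.2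
    refine Fintype.sum_equiv (Equiv.mulRight η0) _ _ (fun η => ?_)
    congr 1
    funext i
    simp [← h0 i]
  have h2 : ∀ η : R → Perm Q, ∑ c ∈ S, f (fun i => η (r i) (c i)) = ∑ c ∈ S, f c := by
    intro η
    refine Finset.sum_bij' (fun c _ i => η (r i) (c i)) (fun c _ i => (η (r i)).symm (c i))
      ?_ ?_ ?_ ?_ ?_
    · intro c hc
      rw [hS, Finset.mem_filter] at hc ⊢
      refine ⟨Finset.mem_univ _, fun i j hr h => hc.2 i j hr ?_⟩
      simp only [hr] at h
      exact (η (r j)).injective h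
    · intro c hc
      rw [hS, Finset.mem_filter] at hc ⊢
      refine ⟨Finset.mem_univ _, fun i j hr h => hc.2 i j hr ?_⟩
      simp only [hr] at h
      exact (η (r j)).symm.injective h
    · intro c hc; funext i; simp
    · intro c hc; funext i; simp
    · intro c hc; rfl
  calc _ = ∑ c ∈ S, ∑ η : R → Perm Q, f (fun i => η (r i) (c i)) := by
        rw [Finset.sum_congr rfl h1, Finset.sum_const, nsmul_eq_mul]
    _ = ∑ η : R → Perm Q, ∑ c ∈ S, f (fun i => η (r i) (c i)) := Finset.sum_comm
    _ = _ := by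
        rw [Finset.sum_congr rfl (fun η _ => h2 η), Finset.sum_const, nsmul_eq_mul]; rfl

lemma card_blk {ι R Q : Type*} [Fintype ι] [Fintype R] [Fintype Q]
    [DecidableEq ι] [DecidableEq R] [DecidableEq Q] (r : ι → R)
    [DecidablePred (fun c : ι → Q => Blk r c)] :
    (Finset.univ.filter (fun c : ι → Q => Blk r c)).card
      = ∏ x : R, (Fintype.card Q).descFactorial (Fintype.card {i // r i = x}) := by
  rw [← Fintype.card_subtype]
  let e : {c : ι → Q // Blk r c} ≃ ((x : R) → ({i // r i = x} ↪ Q)) :=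
    { toFun := fun c x => ⟨fun i => c.1 i, fun i j h =>
        Subtype.ext (c.2 i j (by rw [i.2, j.2]) h)⟩
      invFun := fun g => ⟨fun i => g (r i) ⟨i, rfl⟩, fun i j hr h => by
        have key : ∀ (x y : R) (hxy : x = y) (hi : r i = x) (hj : r j = y),
            g x ⟨i, hi⟩ = g y ⟨j, hj⟩ → i = j := by
          rintro x y rfl hi hj h
          have := (g x).injective h
          exact congrArg Subtype.val this
        exact key _ _ hr rfl rfl h⟩
      left_inv := fun c => rfl
      right_inv := fun g => by
        funext x
        ext i
        obtain ⟨i, rfl⟩ := i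
        rfl }
  rw [Fintype.card_congr e, Fintype.card_pi]
  simp [Fintype.card_embedding_eq]

lemma inj_avg {ι Q : Type*} [Fintype ι] [Fintype Q] [DecidableEq ι] [DecidableEq Q]
    [DecidablePred (fun c : ι → Q => Function.Injective c)]
    (f : (ι → Q) → ℝ) (c0 : ι → Q) (hc0 : Function.Injective c0) :
    ((Fintype.card Q).descFactorial (Fintype.card ι) : ℝ) * ∑ σ : Perm Q, f (fun i => σ (c0 i))
      = ((Fintype.card Q).factorial : ℝ)
        * ∑ c ∈ Finset.univ.filter (fun c : ι → Q => Function.Injective c), f c := by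
  have hb : ∀ c : ι → Q, Blk (fun _ => ()) c ↔ Function.Injective c := fun c =>
    ⟨fun h i j => h i j rfl, fun h i j _ hh => h hh⟩
  classical
  have := block_avg (fun _ : ι => ()) f c0 ((hb c0).2 hc0)
  rw [card_blk] at this
  simp only [hb] at this
  rw [Fintype.card_congr (Equiv.funUnique Unit (Perm Q)), Fintype.card_perm] at this
  rw [Fintype.prod_unique] at this
  rw [← Equiv.sum_comp (Equiv.funUnique Unit (Perm Q)).symm] at this
  have e : Fintype.card {i : ι // True} = Fintype.card ι :=
    Fintype.card_congr (Equiv.subtypeUnivEquiv (fun _ => trivial))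
  rw [e] at this
  simpa using this

end Orbits

section Convert

lemma EV_permDist {n : ℕ} {X : Type*} [MulAction (Perm (Fin n)) X] (L : List (LazyT n))
    (F : X → ℝ) (x : X) : EV L F x = ∑ σ, permDist L σ * F (σ • x) := by
  induction L generalizing x with
  | nil => simp [EV, permDist]
  | cons e L ih =>
    simp only [EV, permDist, ih, add_mul, Finset.sum_add_distrib, Finset.mul_sum]
    congr 1
    · refine Fintype.sum_equiv (Equiv.mulRight (swap e.1 e.2.1)) _ _ (fun σ => ?_)
      simp [mul_smul, mul_assoc]
    · exact Finset.sum_congr rfl (fun _ _ => by ring)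

lemma sh_iff {n t : ℕ} (ht : t ≤ n) (L : List (LazyT n)) :
    (∀ f : Fin t → Fin n, Function.Injective f →
    placeProb ht L f = ((n - t).factorial : ℝ) / (n.factorial : ℝ)) ↔
    Sh L (Fin.castLE ht) := by
  classical
  have hinj : Function.Injective (Fin.castLE ht) := Fin.castLE_injective ht
  have hd : (((n - t).factorial : ℝ)) * (n.descFactorial t : ℝ) = n.factorial := by
    exact_mod_cast Nat.factorial_mul_descFactorial ht
  have hd0 : (n.descFactorial t : ℝ) ≠ 0 := by
    have := Nat.descFactorial_pos.mpr ht
    positivity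
  have hn0 : (n.factorial : ℝ) ≠ 0 := by positivity
  have hr : ((n - t).factorial : ℝ) / (n.factorial : ℝ) = 1 / n.descFactorial t := by
    field_simp; linarith
  constructor
  · intro h F hF
    have hex : ∃ F' : (Fin t → Fin n) → ℝ, ∀ σ : Perm (Fin n),
        F σ = F' (fun i => σ (Fin.castLE ht i)) := by
      refine ⟨fun u => if hu : ∃ σ : Perm (Fin n), (fun i => σ (Fin.castLE ht i)) = u
        then F hu.choose else 0, fun σ => ?_⟩
      have hu : ∃ τ : Perm (Fin n), (fun i => τ (Fin.castLE ht i))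
        = fun i => σ (Fin.castLE ht i) := ⟨σ, rfl⟩
      refine Eq.trans ?_ (dif_pos hu).symm
      exact (hF _ _ (fun i => congrFun hu.choose_spec i)).symm
    obtain ⟨F', hF'⟩ := hex
    rw [EV_permDist]
    have e1 : ∑ σ, permDist L σ * F (σ • (1 : Perm (Fin n)))
        = ∑ f : Fin t → Fin n, placeProb ht L f * F' f := by
      simp only [placeProb, Finset.sum_mul]
      rw [Finset.sum_comm]
      refine Finset.sum_congr rfl (fun σ _ => ?_)
      rw [Finset.sum_eq_single (fun i => σ (Fin.castLE ht i))]
      · simp [hF']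
      · intro f _ hf
        rw [if_neg, zero_mul]
        intro h; exact hf (funext fun i => (h i).symm)
      · simp
    have e2 : ∑ f : Fin t → Fin n, placeProb ht L f * F' f
        = (1 / (n.descFactorial t : ℝ)) *
          ∑ f ∈ Finset.univ.filter (fun c : Fin t → Fin n => Function.Injective c), F' f := by
      rw [Finset.sum_filter, Finset.mul_sum]
      refine Finset.sum_congr rfl (fun f _ => ?_)
      split_ifs with hf
      · rw [h f hf, hr]
      · have : placeProb ht L f = 0 := by
          unfold placeProb
          refine Finset.sum_eq_zero (fun σ _ => ?_)
          rw [if_neg]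
          intro h
          apply hf
          have : f = σ ∘ Fin.castLE ht := funext fun i => (h i).symm
          rw [this]; exact σ.injective.comp hinj
        simp [this]
    have e3 := inj_avg F' (Fin.castLE ht) hinj
    simp only [Fintype.card_fin] at e3
    rw [e1, e2]
    simp only [hF', Fintype.card_fin]
    field_simp
    linarith
  · intro h f hf
    have h1 := h (fun σ => if ∀ i : Fin t, σ (Fin.castLE ht i) = f i then 1 else 0)
      (fun σ τ hst => by simp only [hst])
    rw [EV_permDist] at h1
    have e3 := inj_avg (fun g => if ∀ i, g i = f i then (1:ℝ) else 0) (Fin.castLE ht) hinj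
    have e4 : ∑ c ∈ Finset.univ.filter (fun c : Fin t → Fin n => Function.Injective c),
        (if ∀ i, c i = f i then (1:ℝ) else 0) = 1 := by
      rw [Finset.sum_eq_single f]
      · simp
      · intro b _ hb; rw [if_neg]; intro h; exact hb (funext h)
      · intro h; simp [hf] at h
    rw [e4] at e3
    simp only [Fintype.card_fin] at e3 h1
    have e5 : placeProb ht L f = ∑ σ, permDist L σ *
        (if ∀ i : Fin t, (σ • (1 : Perm (Fin n))) (Fin.castLE ht i) = f i then 1 else 0) := by
      unfold placeProb
      refine Finset.sum_congr rfl (fun σ _ => ?_)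
      simp
    rw [e5, h1, hr]
    field_simp
    linarith

end Convert

section Naive

variable {P : Type*} [DecidableEq P] [Fintype P]

/-- all positions other than `c` -/
noncomputable def others (c : P) : List P := (Finset.univ.erase c).toList

lemma others_length (c : P) : (others c).length = Fintype.card P - 1 := by
  simp [others]

lemma others_mem (c x : P) : x ∈ others c ↔ x ≠ c := by simp [others]

lemma others_real (c : P) : ((others c).length : ℝ) = Fintype.card P - 1 := by
  have : 0 < Fintype.card P := Fintype.card_pos_iff.mpr ⟨c⟩
  rw [others_length, Nat.cast_sub (by omega)]; simp

lemma others_valid (c : P) : ∀ e ∈ spread c (others c) (1 / (Fintype.card P : ℝ)),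
    VV e ∧ e.1 = c := by
  have : 0 < Fintype.card P := Fintype.card_pos_iff.mpr ⟨c⟩
  have h : (0:ℝ) < Fintype.card P := by exact_mod_cast this
  refine spread_valid c _ _ (by simp [others_mem]) (by positivity) ?_
  rw [others_real, mul_one_div, div_le_one h]; linarith

lemma spread_unif (c : P) (G : P → ℝ) :
    EV (spread c (others c) (1 / (Fintype.card P : ℝ))) G c
      = (1 / (Fintype.card P : ℝ)) * ∑ x, G x := by
  have : 0 < Fintype.card P := Fintype.card_pos_iff.mpr ⟨c⟩
  have h : (0:ℝ) < Fintype.card P := by exact_mod_cast this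
  rw [spread_eval]
  · have h2 : ((others c).map (fun x => G (swap c x • c))).sum = ∑ x ∈ Finset.univ.erase c, G x := by
      simp [others, Finset.sum_map_toList]
    rw [h2, others_real, ← Finset.add_sum_erase _ _ (Finset.mem_univ c)]
    field_simp; ring
  · exact Finset.nodup_toList _
  · positivity
  · rw [others_real, mul_one_div, div_le_one h]; linarith
  · intro x hx y hy hxy
    rw [others_mem] at hx hy
    simp [swap_apply_of_ne_of_ne hx hxy]

lemma sh_one (c : P) :
    Sh (spread c (others c) (1 / (Fintype.card P : ℝ))) (fun _ : Fin 1 => c) := by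
  intro F hF
  have h1 : ∀ σ : Perm P, F σ = F (swap c (σ c)) := fun σ => hF _ _ (by simp)
  rw [EV_congr _ F (fun x : P => F (swap c x)) 1 c (fun ρ => by simpa using h1 ρ), spread_unif]
  have := inj_avg (fun u : Fin 1 → P => F (swap c (u 0))) (fun _ => c)
    (Function.injective_of_subsingleton _)
  have hi : ∀ u : Fin 1 → P, Function.Injective u := fun u => Function.injective_of_subsingleton _
  simp only [hi, Finset.filter_true] at this
  rw [← Equiv.sum_comp (Equiv.funUnique (Fin 1) P).symm] at this
  simp only [← h1] at this
  simp only [Fintype.card_fin, Nat.descFactorial_one, Equiv.funUnique_symm_apply,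
    uniqueElim_const] at this
  have : 0 < Fintype.card P := Fintype.card_pos_iff.mpr ⟨c⟩
  have h : (0:ℝ) < Fintype.card P := by exact_mod_cast this
  field_simp
  linarith

/-- the homomorphism `Perm P → Perm (Option P)` -/
def optHom (P : Type*) : Perm P →* Perm (Option P) :=
  MonoidHom.mk' (fun σ => optionCongr σ) (fun σ τ => by ext x; cases x <;> simp)

lemma optHom_swap (a b : P) : optHom P (swap a b) = swap (some a) (some b) := by
  simp [optHom]

lemma EV_opt (M : List (P × P × ℝ)) (F : Perm (Option P) → ℝ) (x : P) :
    ∑ σ, EV (M.map (fun e => (some e.1, some e.2.1, e.2.2))) F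
        (swap none (some x) * optHom P σ)
      = EV M (fun y => ∑ σ, F (swap none (some y) * optHom P σ)) x := by
  induction M generalizing x with
  | nil => rfl
  | cons e M ih =>
    simp only [EV, List.map_cons, Finset.sum_add_distrib, ← Finset.mul_sum]
    rw [ih, ← ih (swap e.1 e.2.1 • x)]
    congr 2
    refine Fintype.sum_equiv (Equiv.mulLeft (swap e.1 e.2.1)) _ _ (fun σ => ?_)
    congr 1
    have key : swap ((swap (some e.1) (some e.2.1)) none) ((swap (some e.1) (some e.2.1)) (some x))
        = swap none (some (swap e.1 e.2.1 • x)) := by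
      rw [← optHom_swap]; simp [optHom, -optionCongr_swap]
    rw [smul_eq_mul, ← mul_assoc, Equiv.mul_swap_eq_swap_mul, Equiv.coe_mulLeft, map_mul,
      optHom_swap, mul_assoc, key]

lemma sh_step {ι : Type*} (L : List (P × P × ℝ)) (s : ι → P) (c : P) (h : Sh L s) :
    Sh (L.map (fun e => (some e.1, some e.2.1, e.2.2)) ++
      (some c, none, (Fintype.card P : ℝ) / (Fintype.card P + 1)) ::
      (spread c (others c) (1 / (Fintype.card P : ℝ))).map
        (fun e => (some e.1, some e.2.1, e.2.2))) (Option.map s) := by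
  intro F hF
  have hpos : 0 < Fintype.card P := Fintype.card_pos_iff.mpr ⟨c⟩
  have hp : (0:ℝ) < Fintype.card P := by exact_mod_cast hpos
  set n := Fintype.card P with hn
  set Sp := spread c (others c) (1 / (n : ℝ)) with hSp
  rw [EV_append]
  have l1 := EV_lift (X := Perm (Option P)) (optHom P) some optHom_swap L
    (EV ((some c, none, (n : ℝ) / (n + 1)) ::
      Sp.map (fun e => (some e.1, some e.2.1, e.2.2))) F) 1 1
  simp only [map_one, smul_eq_mul, mul_one] at l1
  rw [l1, h]
  · simp only [EV, Finset.sum_add_distrib, ← Finset.mul_sum]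
    have c1 : ∑ σ, EV (Sp.map (fun e => (some e.1, some e.2.1, e.2.2))) F (optHom P σ)
        = ∑ σ, F (optHom P σ) := by
      have := EV_sum_smul (X := Perm (Option P)) (optHom P)
        (Sp.map (fun e => (some e.1, some e.2.1, e.2.2))) (by
          intro e he
          rw [List.mem_map] at he
          obtain ⟨e, -, rfl⟩ := he
          exact ⟨_, optHom_swap e.1 e.2.1⟩) F 1
      simpa using this
    have c2 := EV_opt Sp F c
    rw [hSp, spread_unif, ← hSp] at c2
    simp only [smul_eq_mul, swap_comm (some c) none]
    rw [c1, c2]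
    have c3 : ∑ τ, F τ = ∑ σ, F (optHom P σ)
        + ∑ x, ∑ σ, F (swap none (some x) * optHom P σ) := by
      rw [← Equiv.sum_comp Equiv.Perm.decomposeOption.symm, Fintype.sum_prod_type,
        Fintype.sum_option]
      simp [optHom]
      rfl
    rw [c3, Fintype.card_option, ← hn, Nat.factorial_succ]
    have : (n.factorial : ℝ) ≠ 0 := by positivity
    push_cast
    field_simp
    ring
  · intro σ τ hst
    refine EV_congr _ _ _ _ _ (fun ρ => hF _ _ ?_)
    intro i
    cases i with
    | none => simp [optHom]
    | some i => simp [optHom, hst]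

lemma sh_transport {P' ι ι' : Type*} [DecidableEq P'] [Fintype P'] (e : P ≃ P')
    (k : ι' → ι) (L : List (P × P × ℝ)) (s : ι → P) (h : Sh L s) :
    Sh (L.map (fun x => (e x.1, e x.2.1, x.2.2))) (fun i => e (s (k i))) := by
  intro F hF
  have l1 := EV_lift (X := Perm P') (e.permCongrHom : Perm P ≃* Perm P').toMonoidHom e
    (fun a b => by
      ext x
      simp [Equiv.permCongrHom, Equiv.swap_apply_def, Equiv.symm_apply_eq]
      split_ifs <;> simp) L F 1 1
  simp only [map_one, smul_eq_mul, mul_one] at l1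
  rw [l1, h]
  · rw [Fintype.card_congr e]
    congr 1
    exact Equiv.sum_comp (e.permCongrHom : Perm P ≃* Perm P').toEquiv F
  · intro σ τ hst
    refine hF _ _ (fun i => ?_)
    simp [Equiv.permCongrHom, hst]

/-- abstract star shuffles exist, with the naive length -/
lemma naive (d m : ℕ) : ∃ (s : Fin (d + 1) → Fin (m + d + 1))
    (L : List (Fin (m + d + 1) × Fin (m + d + 1) × ℝ)), Function.Injective s ∧
    Sh L s ∧ (∀ e ∈ L, VV e ∧ e.1 = s 0) ∧
    L.length = (d + 1) * m + d * (d + 1) / 2 := by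
  induction d with
  | zero =>
    refine ⟨fun _ => 0, _, fun i j _ => Fin.ext (by omega), sh_one 0, others_valid 0, ?_⟩
    rw [spread_length, others_length]; simp
  | succ d ih =>
    obtain ⟨s, L, hs, hL, hv, hl⟩ := ih
    have h1 := sh_step L s (s 0) hL
    have h2 := sh_transport (finSuccEquivLast (n := m + d + 1)).symm
      (finSuccEquivLast (n := d + 1)) _ _ h1
    refine ⟨_, _, ?_, h2, ?_, ?_⟩
    · exact finSuccEquivLast.symm.injective.comp
        ((Option.map_injective hs).comp finSuccEquivLast.injective)
    · have h0 : finSuccEquivLast (0 : Fin (d + 1 + 1)) = some 0 :=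
        finSuccEquivLast_castSucc (0 : Fin (d + 1))
      rw [h0]
      intro e he
      simp only [List.map_append, List.map_cons, List.map_map, List.mem_append, List.mem_map,
        List.mem_cons] at he
      rcases he with ⟨e, he, rfl⟩ | rfl | ⟨e, he, rfl⟩
      · obtain ⟨⟨a, b, b'⟩, c⟩ := hv e he
        exact ⟨⟨by simpa using a, b, b'⟩, by simp [c]⟩
      · refine ⟨⟨by simp [-finSuccEquivLast_symm_none, -finSuccEquivLast_symm_some], by dsimp; positivity, ?_⟩, by simp⟩
        dsimp only
        rw [div_le_one (by positivity)]; linarith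
      · obtain ⟨⟨a, b, b'⟩, c⟩ := others_valid _ e he
        exact ⟨⟨by simpa using a, b, b'⟩, by simp [c]⟩
    · simp only [List.length_map, List.length_append, List.length_cons, hl, spread_length,
        others_length, Fintype.card_fin]
      have : (d + 1) * (d + 1 + 1) = d * (d + 1) + (d + 1) * 2 := by ring
      rw [this, Nat.add_mul_div_right _ _ (by norm_num)]
      have : m + d + 1 - 1 = m + d := by omega
      rw [this]
      ring

end Naive

section Impl

lemma factor {P ι : Type*} (s : ι → P) (F : Perm P → ℝ)
    (hF : ∀ σ τ : Perm P, (∀ i, σ (s i) = τ (s i)) → F σ = F τ) :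
    ∃ F' : (ι → P) → ℝ, ∀ σ : Perm P, F σ = F' (fun i => σ (s i)) := by
  classical
  refine ⟨fun u => if hu : ∃ σ : Perm P, (fun i => σ (s i)) = u
    then F hu.choose else 0, fun σ => ?_⟩
  have hu : ∃ τ : Perm P, (fun i => τ (s i)) = fun i => σ (s i) := ⟨σ, rfl⟩
  refine Eq.trans ?_ (dif_pos hu).symm
  exact (hF _ _ (fun i => congrFun hu.choose_spec i)).symm

/-- The virtual program `V`, starting with virtual position `c` at the real centre `z` and ending
with `c'` there, can be implemented by `ℓ` star transpositions. -/
def Impl {P R : Type*} [DecidableEq P] [DecidableEq R] (ι : Type*) (z : R) (c : P)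
    (V : List (P × P × ℝ)) (c' : P) (ℓ : ℕ) : Prop :=
  ∀ π : P ≃ R, π c = z → ∃ L : List (R × R × ℝ), L.length = ℓ ∧ (∀ e ∈ L, VV e ∧ e.1 = z) ∧
    ∃ π' : P ≃ R, π' c' = z ∧ ∀ (F : (ι → R) → ℝ) (g : ι → P),
      EV L F (fun i => π (g i)) = EV V (fun h => F (fun i => π' (h i))) g

variable {P R ι : Type*} [DecidableEq P] [DecidableEq R] {z : R}

lemma Impl.append {c c1 c2 : P} {V1 V2 : List (P × P × ℝ)} {l1 l2 : ℕ}
    (h1 : Impl ι z c V1 c1 l1) (h2 : Impl ι z c1 V2 c2 l2) :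
    Impl ι z c (V1 ++ V2) c2 (l1 + l2) := by
  intro π hπ
  obtain ⟨L1, hl1, hv1, π1, hπ1, e1⟩ := h1 π hπ
  obtain ⟨L2, hl2, hv2, π2, hπ2, e2⟩ := h2 π1 hπ1
  refine ⟨L1 ++ L2, by simp [hl1, hl2], ?_, π2, hπ2, ?_⟩
  · intro e he
    rcases List.mem_append.mp he with h | h
    exacts [hv1 e h, hv2 e h]
  · intro F g
    rw [EV_append, EV_append, e1]
    congr 1
    funext h
    exact e2 F h

lemma Impl.nil (c : P) : Impl ι z c [] c 0 := by
  intro π hπ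
  exact ⟨[], rfl, by simp, π, hπ, fun F g => rfl⟩

lemma Impl.move {c c' : P} (h : c ≠ c') : Impl ι z c [] c' 1 := by
  intro π hπ
  refine ⟨[(z, π c', 1)], rfl, ?_, π.trans (swap z (π c')), by simp, ?_⟩
  · intro e he
    rw [List.mem_singleton] at he
    subst he
    exact ⟨⟨by rw [← hπ]; simpa using h, by norm_num, by norm_num⟩, rfl⟩
  · intro F g
    simp only [EV]
    norm_num
    rfl

lemma Impl.star {c : P} (V : List (P × P × ℝ)) (hV : ∀ e ∈ V, VV e ∧ e.1 = c) :
    Impl ι z c V c V.length := by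
  induction V with
  | nil => exact Impl.nil c
  | cons e V ih =>
    have h1 : Impl ι z c [e] c 1 := by
      intro π hπ
      obtain ⟨⟨a, b, b'⟩, hc⟩ := hV e (by simp)
      refine ⟨[(z, π e.2.1, e.2.2)], rfl, ?_, π, hπ, ?_⟩
      · intro x hx
        rw [List.mem_singleton] at hx
        subst hx
        exact ⟨⟨by rw [← hπ, ← hc]; simpa using a, b, b'⟩, rfl⟩
      · intro F g
        simp only [EV]
        congr 3
        funext i
        simp only [Pi.smul_apply, Perm.smul_def]
        rw [← hπ, ← hc]
        simp only [Equiv.swap_apply_def, Equiv.apply_eq_iff_eq]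
        split_ifs <;> rfl
    have := h1.append (ih (fun e he => hV e (by simp [he])))
    simpa [add_comm] using this

lemma fin_of_impl [Fintype P] {n t : ℕ} (ht : t + 1 ≤ n) (hP : Fintype.card P = n)
    (V : List (P × P × ℝ)) (g0 : Fin (t + 1) → P) (hg : Function.Injective g0) (hV : Sh V g0)
    (c' : P) (l : ℕ) (hI : Impl (Fin (t + 1)) (⟨0, by omega⟩ : Fin n) (g0 0) V c' l) :
    ∃ (L : List (LazyT n)), L.length = l ∧ IsTShuffle ht L ∧ ∀ e ∈ L, e.IsStar := by
  let π0 : P ≃ Fin n := Fintype.equivFinOfCardEq hP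
  obtain ⟨ρ, hρ⟩ := exists_perm_ext (fun i => π0 (g0 i)) (Fin.castLE ht)
    (π0.injective.comp hg) (Fin.castLE_injective ht)
  let π := π0.trans ρ
  have hπ : ∀ i, π (g0 i) = Fin.castLE ht i := hρ
  obtain ⟨L, hl, hv, π', hπ', e⟩ := hI π (by rw [hπ]; rfl)
  refine ⟨L, hl, ⟨fun e he => (hv e he).1, (sh_iff ht L).2 ?_⟩, fun e he => ?_⟩
  · intro F hF
    obtain ⟨F', hF'⟩ := factor _ F hF
    rw [EV_congr L F F' 1 (Fin.castLE ht) (fun ρ => by rw [smul_eq_mul, mul_one]; exact hF' ρ)]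
    have h1 := e F' g0
    simp only [hπ] at h1
    have h2 := hV (fun σ => F' (fun i => π' (σ (g0 i)))) (fun σ τ h => by simp only [h])
    have h3 := EV_smul V (fun h : Fin (t + 1) → P => F' (fun i => π' (h i))) g0 1
    rw [one_smul] at h3
    refine h1.trans (h3.symm.trans (h2.trans ?_))
    rw [hP, Fintype.card_fin]
    congr 1
    refine Fintype.sum_equiv (Equiv.equivCongr π π') _ _ (fun σ => ?_)
    rw [hF']
    congr 1
    funext i
    rw [← hπ]
    simp [Equiv.equivCongr]
  · have := (hv e he).2
    unfold LazyT.IsStar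
    rw [this]

lemma naive_list (d m : ℕ) (ht : d + 1 ≤ m + d + 1) : ∃ (L : List (LazyT (m + d + 1))),
    L.length = (d + 1) * m + d * (d + 1) / 2 ∧ IsTShuffle ht L ∧ ∀ e ∈ L, e.IsStar := by
  obtain ⟨s, L, hs, hL, hv, hl⟩ := naive d m
  have := fin_of_impl (P := Fin (m + d + 1)) ht (by simp) L s hs hL (s 0) _ (Impl.star L hv)
  rwa [hl] at this

lemma Utstar_le {t n : ℕ} (ht : t ≤ n) (L : List (LazyT n)) (h1 : IsTShuffle ht L)
    (h2 : ∀ e ∈ L, e.IsStar) : Utstar t n ≤ L.length :=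
  Nat.sInf_le ⟨ht, L, rfl, h1, h2⟩

lemma Utstar_naive (d m : ℕ) :
    Utstar (d + 1) (m + d + 1) ≤ (d + 1) * m + d * (d + 1) / 2 := by
  obtain ⟨L, h1, h2, h3⟩ := naive_list d m (by omega)
  rw [← h1]; exact Utstar_le _ L h2 h3

lemma Utstar_attained (d m : ℕ) (ht : d + 1 ≤ m + d + 1) : ∃ (L : List (LazyT (m + d + 1))),
    L.length = Utstar (d + 1) (m + d + 1) ∧ IsTShuffle ht L ∧ ∀ e ∈ L, e.IsStar := by
  obtain ⟨L, h1, h2, h3⟩ := naive_list d m ht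
  obtain ⟨_, L, h⟩ := Nat.sInf_mem (s := { ℓ : ℕ | ∃ (ht : d + 1 ≤ m + d + 1)
    (L : List (LazyT (m + d + 1))), L.length = ℓ ∧ IsTShuffle ht L ∧ ∀ e ∈ L, e.IsStar })
    ⟨_, ht, L, rfl, h2, h3⟩
  exact ⟨L, h⟩

lemma Utstar_two_three : 1 ≤ Utstar 2 3 := by
  by_contra h
  obtain ⟨L, h1, h2, h3⟩ := Utstar_attained 1 1 (by norm_num)
  have h0 : Utstar (1 + 1) (1 + 1 + 1) = 0 := by
    have : Utstar 2 3 = 0 := by omega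
    exact this
  rw [h0, List.length_eq_zero_iff] at h1
  subst h1
  have := h2.2 (Fin.castLE (by norm_num)) (Fin.castLE_injective _)
  rw [placeProb, Finset.sum_eq_single 1] at this
  · simp [permDist, Nat.factorial] at this
  · intro b _ hb
    simp [permDist, hb]
  · simp

end Impl

section Grid

variable {k : ℕ}

/-- column `c` -/
def colE (c : Fin k) : Fin 3 ↪ Fin 3 × Fin k := ⟨fun r => (r, c), fun a b h => by simpa using h⟩

/-- row `r` -/
def rowE (r : Fin 3) : Fin k ↪ Fin 3 × Fin k := ⟨fun c => (r, c), fun a b h => by simpa using h⟩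

lemma via_swap {Q P : Type*} [DecidableEq Q] [DecidableEq P] (j : Q ↪ P) (a b : Q) :
    Equiv.Perm.viaEmbeddingHom j (swap a b) = swap (j a) (j b) := by
  ext x
  rw [Equiv.Perm.viaEmbeddingHom_apply]
  by_cases hx : x ∈ Set.range j
  · obtain ⟨y, rfl⟩ := hx
    rw [Equiv.Perm.viaEmbedding_apply]
    simp only [swap_apply_def, j.injective.eq_iff]
    split_ifs <;> rfl
  · rw [Equiv.Perm.viaEmbedding_apply_of_notMem _ _ _ hx, swap_apply_of_ne_of_ne]
    · rintro rfl; exact hx ⟨a, rfl⟩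
    · rintro rfl; exact hx ⟨b, rfl⟩

/-- permutation of column `c` -/
noncomputable def colAct (c : Fin k) : Perm (Fin 3) →* Perm (Fin 3 × Fin k) :=
  Equiv.Perm.viaEmbeddingHom (colE c)

/-- permutation of row `r` -/
noncomputable def rowAct (r : Fin 3) : Perm (Fin k) →* Perm (Fin 3 × Fin k) :=
  Equiv.Perm.viaEmbeddingHom (rowE r)

lemma colAct_apply (c : Fin k) (ρ : Perm (Fin 3)) (x : Fin 3 × Fin k) :
    colAct c ρ x = if x.2 = c then (ρ x.1, x.2) else x := by
  obtain ⟨r, c'⟩ := x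
  unfold colAct
  rw [Equiv.Perm.viaEmbeddingHom_apply]
  split_ifs with h
  · dsimp only at h; subst h
    exact Equiv.Perm.viaEmbedding_apply ρ (colE c') r
  · refine Equiv.Perm.viaEmbedding_apply_of_notMem _ _ _ ?_
    rintro ⟨y, hy⟩
    apply h
    exact (congrArg Prod.snd hy).symm

lemma rowAct_apply (r : Fin 3) (ρ : Perm (Fin k)) (x : Fin 3 × Fin k) :
    rowAct r ρ x = if x.1 = r then (x.1, ρ x.2) else x := by
  obtain ⟨r', c⟩ := x
  unfold rowAct
  rw [Equiv.Perm.viaEmbeddingHom_apply]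
  split_ifs with h
  · dsimp only at h; subst h
    exact Equiv.Perm.viaEmbedding_apply ρ (rowE r') c
  · refine Equiv.Perm.viaEmbedding_apply_of_notMem _ _ _ ?_
    rintro ⟨y, hy⟩
    apply h
    exact (congrArg Prod.fst hy).symm

/-- a list of lazy transpositions carried along `j` -/
def lmap {Q P : Type*} (j : Q → P) (L : List (Q × Q × ℝ)) : List (P × P × ℝ) :=
  L.map (fun e => (j e.1, j e.2.1, e.2.2))

lemma lmap_valid {Q P : Type*} (j : Q → P) (hj : Function.Injective j) (L : List (Q × Q × ℝ))
    (c : Q) (h : ∀ e ∈ L, VV e ∧ e.1 = c) : ∀ e ∈ lmap j L, VV e ∧ e.1 = j c := by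
  intro e he
  simp only [lmap, List.mem_map] at he
  obtain ⟨e, he, rfl⟩ := he
  obtain ⟨⟨a, b, b'⟩, hc⟩ := h e he
  exact ⟨⟨fun h => a (hj h), b, b'⟩, by simp [hc]⟩

lemma lmap_length {Q P : Type*} (j : Q → P) (L : List (Q × Q × ℝ)) :
    (lmap j L).length = L.length := by simp [lmap]

/-- the column phase -/
def cols (L3 : List (Fin 3 × Fin 3 × ℝ)) : List (Fin k) →
    List ((Fin 3 × Fin k) × (Fin 3 × Fin k) × ℝ)
  | [] => []
  | c :: cs => lmap (colE c) L3 ++ cols L3 cs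

lemma cols_inv (L3 : List (Fin 3 × Fin 3 × ℝ)) (s3 : Fin 3 → Fin 3) (hs : Function.Surjective s3)
    (h3 : Sh L3 s3) {ι : Type*} (F : (ι → Fin 3 × Fin k) → ℝ) (cs : List (Fin k)) :
    ∀ c ∈ cs, ∀ (ρ : Perm (Fin 3)) (g : ι → Fin 3 × Fin k),
      EV (cols L3 cs) F (colAct c ρ • g) = EV (cols L3 cs) F g := by
  induction cs with
  | nil => simp
  | cons c0 cs ih =>
    intro c hc ρ g
    have key : ∀ g : ι → Fin 3 × Fin k, EV (cols L3 (c0 :: cs)) F g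
        = (1 / ((Fintype.card (Fin 3)).factorial : ℝ)) *
          ∑ ρ, EV (cols L3 cs) F (colAct c0 ρ • g) := by
      intro g
      rw [cols, EV_append]
      have l1 := EV_lift (colAct c0) (colE c0) (via_swap (colE c0)) L3 (EV (cols L3 cs) F) g 1
      rw [map_one, one_smul] at l1
      unfold lmap
      rw [l1]
      apply h3
      intro σ τ h
      have : σ = τ := by
        ext x; obtain ⟨i, rfl⟩ := hs x; rw [h]
      rw [this]
    rw [key, key]
    congr 1
    by_cases hcc : c = c0
    · subst hcc
      simp only [← mul_smul, ← map_mul]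
      exact Fintype.sum_equiv (Equiv.mulRight ρ) _ _ (fun _ => rfl)
    · have hmem : c ∈ cs := by
        rcases List.mem_cons.mp hc with h | h
        exacts [absurd h hcc, h]
      refine Finset.sum_congr rfl (fun ρ' _ => ?_)
      rw [← ih c hmem ρ (colAct c0 ρ' • g)]
      congr 1
      funext i
      simp only [Pi.smul_apply, Perm.smul_def, colAct_apply]
      split_ifs <;> simp_all

/-- pairing of a row map and a column map -/
def zp {ι A B : Type*} (r : ι → A) (c : ι → B) : ι → A × B := fun i => (r i, c i)

lemma zp_inj {ι A B : Type*} (r : ι → A) (c : ι → B) :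
    Function.Injective (zp r c) ↔ Blk r c :=
  ⟨fun h i j h1 h2 => h (Prod.ext h1 h2), fun h i j hh =>
    h i j (congrArg Prod.fst hh) (congrArg Prod.snd hh)⟩

lemma blk_symm {ι A B : Type*} (r : ι → A) (c : ι → B) : Blk r c ↔ Blk c r :=
  ⟨fun h i j h1 h2 => h i j h2 h1, fun h i j h1 h2 => h i j h2 h1⟩

/-- invariance under column permutations -/
def ColInv {ι : Type*} (Φ : (ι → Fin 3 × Fin k) → ℝ) : Prop :=
  ∀ (c : Fin k) (ρ : Perm (Fin 3)) (g : ι → Fin 3 × Fin k), Φ (colAct c ρ • g) = Φ g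

lemma ColInv.eq {ι : Type*} {Φ : (ι → Fin 3 × Fin k) → ℝ} (h : ColInv Φ) (r r' : ι → Fin 3)
    (c : ι → Fin k) (h1 : Blk r c) (h2 : Blk r' c) : Φ (zp r c) = Φ (zp r' c) := by
  obtain ⟨η, hη⟩ := exists_blk_ext c r r' ((blk_symm _ _).1 h1) ((blk_symm _ _).1 h2)
  have key : ∀ s : Finset (Fin k),
      Φ (fun i => if c i ∈ s then (r' i, c i) else (r i, c i)) = Φ (zp r c) := by
    intro s
    induction s using Finset.induction_on with
    | empty => simp only [Finset.notMem_empty, if_false]; rfl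
    | insert a s ha ih =>
      rw [← ih]
      rw [← h a (η a) (fun i => if c i ∈ s then (r' i, c i) else (r i, c i))]
      congr 1
      funext i
      simp only [Pi.smul_apply, Perm.smul_def, colAct_apply, Finset.mem_insert]
      by_cases hca : c i = a
      · have : c i ∉ s := by rw [hca]; exact ha
        simp only [hca, ha, true_or, if_true, if_false]
        rw [← hη i, hca]
      · simp only [hca, false_or]
        split_ifs <;> simp_all
  have := key Finset.univ
  simp only [Finset.mem_univ, if_true] at this
  exact this.symm

open Classical in
lemma EV_sum_inj {P ι : Type*} [DecidableEq P] [Fintype P] [Fintype ι]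
    (V : List (P × P × ℝ)) (F : (ι → P) → ℝ) :
    ∑ g ∈ Finset.univ.filter (fun g : ι → P => Function.Injective g), EV V F g
      = ∑ g ∈ Finset.univ.filter (fun g : ι → P => Function.Injective g), F g := by
  induction V with
  | nil => rfl
  | cons e V ih =>
    simp only [EV, Finset.sum_add_distrib, ← Finset.mul_sum]
    have : ∑ g ∈ Finset.univ.filter (fun g : ι → P => Function.Injective g),
        EV V F (swap e.1 e.2.1 • g)
        = ∑ g ∈ Finset.univ.filter (fun g : ι → P => Function.Injective g), EV V F g := by
      refine Finset.sum_bij' (fun g _ => swap e.1 e.2.1 • g) (fun g _ => swap e.1 e.2.1 • g)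
        ?_ ?_ ?_ ?_ ?_
      · intro g hg
        simp only [Finset.mem_filter, Finset.mem_univ, true_and] at hg ⊢
        exact (swap e.1 e.2.1).injective.comp hg
      · intro g hg
        simp only [Finset.mem_filter, Finset.mem_univ, true_and] at hg ⊢
        exact (swap e.1 e.2.1).injective.comp hg
      · intro g hg; rw [← mul_smul]; simp
      · intro g hg; rw [← mul_smul]; simp
      · intro g hg; rfl
    rw [this, ih]; ring

lemma row_eval {t : ℕ} (ht : t ≤ k) (L : List (LazyT k)) (hL : Sh L (Fin.castLE ht)) {ι : Type*}
    (Ψ : (ι → Fin 3 × Fin k) → ℝ) (r : Fin 3) (y : ι → Fin 3 × Fin k)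
    (hy : ∀ i, (y i).1 = r → ((y i).2 : ℕ) < t) :
    EV (lmap (rowE r) L) Ψ y
      = (1 / (k.factorial : ℝ)) * ∑ α : Perm (Fin k), Ψ (rowAct r α • y) := by
  have l1 := EV_lift (rowAct r) (rowE r) (via_swap (rowE r)) L Ψ y 1
  rw [map_one, one_smul] at l1
  unfold lmap
  rw [l1, hL, Fintype.card_fin]
  intro σ τ h
  congr 1
  funext i
  simp only [Pi.smul_apply, Perm.smul_def, rowAct_apply]
  split_ifs with hi
  · have := h ⟨(y i).2, hy i hi⟩
    have e : Fin.castLE ht ⟨(y i).2, hy i hi⟩ = (y i).2 := Fin.ext rfl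
    rw [e] at this
    rw [this]
  · rfl

/-- triples as functions -/
def tripleEquiv (A : Type*) : (Fin 3 → A) ≃ A × A × A :=
  { toFun := fun η => (η 0, η 1, η 2)
    invFun := fun x => ![x.1, x.2.1, x.2.2]
    left_inv := fun η => by funext i; fin_cases i <;> rfl
    right_inv := fun x => rfl }

open Classical in
/-- number of column maps compatible with `r` -/
noncomputable def NN (k : ℕ) (r : Fin 4 → Fin 3) : ℝ :=
  ((Finset.univ.filter (fun c : Fin 4 → Fin k => Blk r c)).card : ℝ)

open Classical in
/-- sum over column maps compatible with `r` -/
noncomputable def JJ (Φ : (Fin 4 → Fin 3 × Fin k) → ℝ) (r : Fin 4 → Fin 3) : ℝ :=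
  ∑ c ∈ Finset.univ.filter (fun c : Fin 4 → Fin k => Blk r c), Φ (zp r c)

lemma rows_eval (h4 : 4 ≤ k) (h2 : 2 ≤ k) (LA LB : List (LazyT k)) (hA : Sh LA (Fin.castLE h4))
    (hB : Sh LB (Fin.castLE h2)) (Φ : (Fin 4 → Fin 3 × Fin k) → ℝ) (y : Fin 4 → Fin 3 × Fin k)
    (hinj : Function.Injective y) (hy0 : ∀ i, (y i).1 = 0 → ((y i).2 : ℕ) < 4)
    (hy1 : ∀ i, (y i).1 = 1 → ((y i).2 : ℕ) < 2) :
    (1 / (k.factorial : ℝ)) * ∑ γ : Perm (Fin k),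
      EV (lmap (rowE 0) LA ++ lmap (rowE 1) LB) Φ (rowAct 2 γ • y)
      = JJ Φ (fun i => (y i).1) / NN k (fun i => (y i).1) := by
  classical
  have hb : Blk (fun i => (y i).1) (fun i => (y i).2) := fun i j h1 h2 => hinj (Prod.ext h1 h2)
  have e1 : ∀ γ : Perm (Fin k),
      EV (lmap (rowE 0) LA ++ lmap (rowE 1) LB) Φ (rowAct 2 γ • y)
      = (1 / (k.factorial : ℝ)) * ∑ α : Perm (Fin k), (1 / (k.factorial : ℝ)) * ∑ β : Perm (Fin k),
        Φ (fun i => ((y i).1, (tripleEquiv _).symm (α, β, γ) (y i).1 (y i).2)) := by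
    intro γ
    rw [EV_append, row_eval h4 LA hA _ 0]
    · congr 1
      refine Finset.sum_congr rfl (fun α _ => ?_)
      rw [row_eval h2 LB hB _ 1]
      · congr 1
        refine Finset.sum_congr rfl (fun β _ => ?_)
        congr 1
        funext i
        simp only [Pi.smul_apply, Perm.smul_def, rowAct_apply]
        generalize y i = x
        obtain ⟨a, b⟩ := x
        fin_cases a <;> simp <;> rfl
      · intro i
        simp only [Pi.smul_apply, Perm.smul_def, rowAct_apply]
        have := hy1 i
        generalize y i = x at *
        obtain ⟨a, b⟩ := x
        fin_cases a <;> simp_all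
    · intro i
      simp only [Pi.smul_apply, Perm.smul_def, rowAct_apply]
      have := hy0 i
      generalize y i = x at *
      obtain ⟨a, b⟩ := x
      fin_cases a <;> simp_all
  have e2 := block_avg (fun i => (y i).1) (fun c => Φ (zp (fun i => (y i).1) c)) _ hb
  rw [← Equiv.sum_comp (tripleEquiv (Perm (Fin k))).symm, Fintype.sum_prod_type] at e2
  simp only [Fintype.sum_prod_type] at e2
  have hN : NN k (fun i => (y i).1) ≠ 0 := by
    unfold NN
    have : 0 < (Finset.univ.filter (fun c : Fin 4 → Fin k => Blk (fun i => (y i).1) c)).card :=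
      Finset.card_pos.mpr ⟨fun i => (y i).2, by simpa using hb⟩
    positivity
  have hcard : (Fintype.card (Fin 3 → Perm (Fin k)) : ℝ) = (k.factorial : ℝ) ^ 3 := by
    simp [Fintype.card_perm]
  have hk : (k.factorial : ℝ) ≠ 0 := by positivity
  rw [Finset.sum_congr rfl (fun γ _ => e1 γ)]
  rw [hcard] at e2
  rw [eq_div_iff hN]
  simp only [← Finset.mul_sum]
  have e3 : ∑ γ : Perm (Fin k), ∑ α : Perm (Fin k), ∑ β : Perm (Fin k),
      Φ (fun i => ((y i).1, (tripleEquiv _).symm (α, β, γ) (y i).1 (y i).2))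
      = ∑ α : Perm (Fin k), ∑ β : Perm (Fin k), ∑ γ : Perm (Fin k),
      Φ (fun i => ((y i).1, (tripleEquiv _).symm (α, β, γ) (y i).1 (y i).2)) := by
    rw [Finset.sum_comm]
    exact Finset.sum_congr rfl (fun α _ => Finset.sum_comm)
  rw [e3]
  have e4 : NN k (fun i => (y i).1) * ∑ α : Perm (Fin k), ∑ β : Perm (Fin k), ∑ γ : Perm (Fin k),
      Φ (fun i => ((y i).1, (tripleEquiv _).symm (α, β, γ) (y i).1 (y i).2))
      = (k.factorial : ℝ) ^ 3 * JJ Φ (fun i => (y i).1) := by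
    unfold NN JJ; exact e2
  field_simp
  linarith

end Grid

section Types

variable {k : ℕ}

/-- number of equal pairs, encoded -/
def ty (r : Fin 4 → Fin 3) : Fin 4 :=
  let n := (Finset.univ.filter (fun x : Fin 4 × Fin 4 => x.1 < x.2 ∧ r x.1 = r x.2)).card
  if n = 6 then 0 else if n = 3 then 1 else if n = 2 then 2 else 3

/-- canonical representatives -/
def can : Fin 4 → Fin 4 → Fin 3 := ![![0, 0, 0, 0], ![0, 0, 0, 1], ![0, 0, 1, 1], ![0, 0, 1, 2]]

set_option maxRecDepth 100000 in
lemma exists_can_aux : ∀ r : Fin 4 → Fin 3, ∀ t : Fin 4, ty r = t →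
    ∃ a b : Fin 3, ∃ c d : Fin 4,
    ∀ i, swap 1 b (swap 0 a (r i)) = can t (swap 3 c (swap 2 d i)) := by
  decide +kernel

lemma exists_can (r : Fin 4 → Fin 3) : ∃ (ρ : Perm (Fin 3)) (τ : Perm (Fin 4)),
    ∀ i, r i = ρ (can (ty r) (τ i)) := by
  obtain ⟨a, b, c, d, h⟩ := exists_can_aux r _ rfl
  refine ⟨swap 0 a * swap 1 b, swap 3 c * swap 2 d, fun i => ?_⟩
  have := h i
  simp only [Perm.mul_apply]
  rw [← this]; simp

set_option maxRecDepth 100000 in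
lemma ty_count : ∀ t : Fin 4, (Finset.univ.filter (fun r : Fin 4 → Fin 3 => ty r = t)).card
    = ![3, 24, 18, 36] t := by
  decide +kernel

lemma JJ_row {Φ : (Fin 4 → Fin 3 × Fin k) → ℝ} (h : ColInv Φ) (ρ : Perm (Fin 3))
    (r : Fin 4 → Fin 3) : JJ Φ (fun i => ρ (r i)) = JJ Φ r := by
  classical
  have hb : ∀ c : Fin 4 → Fin k, Blk (fun i => ρ (r i)) c ↔ Blk r c := fun c =>
    ⟨fun h i j h1 h2 => h i j (congrArg ρ h1) h2, fun h i j h1 h2 => h i j (ρ.injective h1) h2⟩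
  unfold JJ
  refine Finset.sum_congr (Finset.filter_congr (fun c _ => hb c)) ?_
  intro c hc
  have hc' : Blk r c := by simpa using hc
  exact h.eq _ _ _ ((hb c).2 hc') hc'

lemma JJ_comp (Φ : (Fin 4 → Fin 3 × Fin k) → ℝ) (τ : Perm (Fin 4)) (r : Fin 4 → Fin 3) :
    JJ Φ (fun i => r (τ i)) = JJ (fun g => Φ (fun i => g (τ i))) r := by
  classical
  unfold JJ
  refine Finset.sum_bij' (fun c _ => fun i => c (τ⁻¹ i)) (fun c _ => fun i => c (τ i)) ?_ ?_ ?_ ?_ ?_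
  · intro c hc
    simp only [Finset.mem_filter, Finset.mem_univ, true_and] at hc ⊢
    intro i j h1 h2
    have := hc (τ⁻¹ i) (τ⁻¹ j) (by simpa using h1) h2
    exact τ⁻¹.injective this
  · intro c hc
    simp only [Finset.mem_filter, Finset.mem_univ, true_and] at hc ⊢
    intro i j h1 h2
    exact τ.injective (hc (τ i) (τ j) h1 h2)
  · intro c hc; funext i; simp
  · intro c hc; funext i; simp
  · intro c hc
    congr 1
    funext i
    simp [zp]

lemma NN_eq (r : Fin 4 → Fin 3) : NN k r = JJ (k := k) (fun _ => 1) r := by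
  simp [NN, JJ]

lemma NN_inv (r r' : Fin 4 → Fin 3) (ρ : Perm (Fin 3)) (τ : Perm (Fin 4))
    (h : ∀ i, r i = ρ (r' (τ i))) : NN k r = NN k r' := by
  have : r = fun i => ρ (r' (τ i)) := funext h
  rw [this, NN_eq, NN_eq, JJ_row (fun _ _ _ => rfl) ρ, JJ_comp]

/-- symmetrized sum -/
noncomputable def SS (Φ : (Fin 4 → Fin 3 × Fin k) → ℝ) (r : Fin 4 → Fin 3) : ℝ :=
  ∑ σ : Perm (Fin 4), JJ Φ (fun i => r (σ i))

lemma SS_inv {Φ : (Fin 4 → Fin 3 × Fin k) → ℝ} (hΦ : ColInv Φ) (r r' : Fin 4 → Fin 3)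
    (ρ : Perm (Fin 3)) (τ : Perm (Fin 4))
    (h : ∀ i, r i = ρ (r' (τ i))) : SS Φ r = SS Φ r' := by
  unfold SS
  have : r = fun i => ρ (r' (τ i)) := funext h
  rw [this]
  refine Fintype.sum_equiv (Equiv.mulLeft τ) _ _ (fun σ => ?_)
  exact JJ_row hΦ ρ (fun i => r' (τ (σ i)))

/-- type averages -/
noncomputable def aa (Φ : (Fin 4 → Fin 3 × Fin k) → ℝ) (t : Fin 4) : ℝ :=
  SS Φ (can t) / NN k (can t) / 24

lemma aa_eq {Φ : (Fin 4 → Fin 3 × Fin k) → ℝ} (hΦ : ColInv Φ) (r : Fin 4 → Fin 3) :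
    (1 / 24 : ℝ) * ∑ σ : Perm (Fin 4), JJ Φ (fun i => r (σ i)) / NN k (fun i => r (σ i))
      = aa Φ (ty r) := by
  obtain ⟨ρ, τ, h⟩ := exists_can r
  have h1 : ∀ σ : Perm (Fin 4), NN k (fun i => r (σ i)) = NN k (can (ty r)) := fun σ =>
    NN_inv _ _ ρ (τ * σ) (fun i => h (σ i))
  simp only [h1, ← Finset.sum_div]
  have h2 : ∑ σ : Perm (Fin 4), JJ Φ (fun i => r (σ i)) = SS Φ r := rfl
  rw [h2, SS_inv hΦ _ _ ρ τ h, aa]; ring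

lemma NN_val (hk : 4 ≤ k) (t : Fin 4) : NN k (can t) =
    ![(k:ℝ) * (k - 1) * (k - 2) * (k - 3), (k:ℝ) * (k * (k - 1) * (k - 2)),
      ((k:ℝ) * (k - 1)) ^ 2, (k:ℝ) ^ 2 * (k * (k - 1))] t := by
  classical
  obtain ⟨m, rfl⟩ := Nat.exists_eq_add_of_le' hk
  unfold NN
  rw [card_blk, Fintype.card_fin, Fin.prod_univ_three]
  have e : ∀ t : Fin 4, (Fintype.card {i // can t i = 0}, Fintype.card {i // can t i = 1},
    Fintype.card {i // can t i = 2}) = ![(4, 0, 0), (3, 1, 0), (2, 2, 0), (2, 1, 1)] t := by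
    decide +kernel
  have e' := e t
  have e1 := congrArg Prod.fst e'
  have e2 := congrArg (fun x => x.2.1) e'
  have e3 := congrArg (fun x => x.2.2) e'
  dsimp only at e1 e2 e3
  have f1 : Fintype.card {i // can t i = 0} = _ := e1
  have g : ∀ (x : Fin 3) (i1 i2 : Fintype {i // can t i = x}), @Fintype.card _ i1 = @Fintype.card _ i2 :=
    fun x i1 i2 => by congr!
  rw [g 0 _ inferInstance, e1, g 1 _ inferInstance, e2, g 2 _ inferInstance, e3]
  fin_cases t <;> simp [Nat.descFactorial] <;> ring

open Classical in
lemma sum_inj_eq (hk : 4 ≤ k) {Φ : (Fin 4 → Fin 3 × Fin k) → ℝ} (hΦ : ColInv Φ) :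
    ∑ g ∈ Finset.univ.filter (fun g : Fin 4 → Fin 3 × Fin k => Function.Injective g), Φ g
      = 3 * NN k (can 0) * aa Φ 0 + 24 * NN k (can 1) * aa Φ 1 + 18 * NN k (can 2) * aa Φ 2
        + 36 * NN k (can 3) * aa Φ 3 := by
  have h1 : ∑ g ∈ Finset.univ.filter (fun g : Fin 4 → Fin 3 × Fin k => Function.Injective g), Φ g
      = ∑ r : Fin 4 → Fin 3, JJ Φ r := by
    unfold JJ
    simp only [Finset.sum_filter]
    rw [← (Equiv.arrowProdEquivProdArrow (Fin 4) (fun _ => Fin 3) (fun _ => Fin k)).symm.sum_comp,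
      Fintype.sum_prod_type]
    refine Finset.sum_congr rfl (fun r _ => Finset.sum_congr rfl (fun c _ => ?_))
    have : (Equiv.arrowProdEquivProdArrow (Fin 4) (fun _ => Fin 3) (fun _ => Fin k)).symm (r, c)
      = zp r c := rfl
    rw [this]
    simp only [zp_inj]
  have h2 : ∑ r : Fin 4 → Fin 3, SS Φ r = 24 * ∑ r : Fin 4 → Fin 3, JJ Φ r := by
    unfold SS
    rw [Finset.sum_comm]
    have : ∀ σ : Perm (Fin 4), ∑ r : Fin 4 → Fin 3, JJ Φ (fun i => r (σ i))
        = ∑ r : Fin 4 → Fin 3, JJ Φ r := fun σ =>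
      Fintype.sum_equiv (Equiv.arrowCongr σ.symm (Equiv.refl _)) _ _ (fun r => rfl)
    simp only [this, Finset.sum_const, Finset.card_univ, Fintype.card_perm, Fintype.card_fin]
    simp [Nat.factorial]
  have hN : ∀ t, NN k (can t) ≠ 0 := by
    intro t
    rw [NN_val hk]
    have : (4:ℝ) ≤ k := by exact_mod_cast hk
    have h0 : (k:ℝ) ≠ 0 := by linarith
    have h1 : (k:ℝ) - 1 ≠ 0 := by linarith
    have h2 : (k:ℝ) - 2 ≠ 0 := by linarith
    have h3 : (k:ℝ) - 3 ≠ 0 := by linarith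
    fin_cases t <;> simp [h0, h1, h2, h3]
  have h3 : ∀ r, SS Φ r = 24 * (NN k (can (ty r)) * aa Φ (ty r)) := by
    intro r
    obtain ⟨ρ, τ, h⟩ := exists_can r
    rw [SS_inv hΦ _ _ ρ τ h, aa]
    have := hN (ty r)
    field_simp
  have h4 : ∑ r : Fin 4 → Fin 3, SS Φ r = 24 * ∑ t : Fin 4, ((![3, 24, 18, 36] t : ℕ) : ℝ)
      * (NN k (can t) * aa Φ t) := by
    simp only [h3, ← Finset.mul_sum]
    congr 1
    rw [← Finset.sum_fiberwise_of_maps_to (t := Finset.univ) (g := ty) (fun _ _ => Finset.mem_univ _)]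
    refine Finset.sum_congr rfl (fun t _ => ?_)
    rw [← ty_count t, ← nsmul_eq_mul]
    refine Finset.sum_eq_card_nsmul (fun r hr => ?_)
    rw [(Finset.mem_filter.mp hr).2]
  rw [h1]
  rw [Fin.sum_univ_four] at h4
  simp at h4
  linarith

end Types

section Program

lemma EV_comm {P X : Type*} [DecidableEq P] [MulAction (Perm P) X] (L : List (P × P × ℝ))
    (F : X → ℝ) (x : X) (θ : Perm P)
    (h : ∀ e ∈ L, swap e.1 e.2.1 * θ = θ * swap e.1 e.2.1) :
    EV L F (θ • x) = EV L (fun x => F (θ • x)) x := by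
  induction L generalizing x with
  | nil => rfl
  | cons e L ih =>
    have h1 := h e (by simp)
    have h2 := fun x => ih x (fun e he => h e (by simp [he]))
    simp only [EV]
    rw [← mul_smul, h1, mul_smul, h2, h2]

lemma EV_pre {P ι : Type*} [DecidableEq P] (L : List (P × P × ℝ)) (F : (ι → P) → ℝ)
    (x : ι → P) (σ : ι → ι) :
    EV L F (fun i => x (σ i)) = EV L (fun y => F (fun i => y (σ i))) x :=
  EV_congr L _ _ _ _ (fun _ => rfl)

/-- slots for the small phase -/
abbrev Slot := Fin 3 × Fin 4

/-- the small phase -/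
def V3' (q p r : ℝ) : List (Slot × Slot × ℝ) :=
  [((0, 0), (0, 1), q), ((0, 0), (1, 0), p), ((0, 0), (0, 2), 1), ((0, 0), (1, 1), r)]

/-- a placement uses legal columns -/
def goodY (y : Fin 4 → Slot) : Prop :=
  Function.Injective y ∧ ∀ i, (y i).1 = 1 → ((y i).2 : ℕ) < 2

instance (y : Fin 4 → Slot) : Decidable (goodY y) := by unfold goodY; infer_instance

/-- start -/
def st0 : Fin 4 → Slot := fun i => (0, i)

/-- alternative start -/
def st1 : Fin 4 → Slot := swap ((0, 0) : Slot) (2, 0) • st0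

/-- outcome of the small phase -/
def leaf (b1 b2 b4 : Bool) (y : Fin 4 → Slot) : Fin 4 → Slot :=
  (if b4 then swap ((0, 0) : Slot) (1, 1) else 1) • swap ((0, 0) : Slot) (0, 2) •
  (if b2 then swap ((0, 0) : Slot) (1, 0) else 1) • (if b1 then swap ((0, 0) : Slot) (0, 1) else 1) • y

lemma leaf_good : ∀ b1 b2 b4 : Bool, goodY (leaf b1 b2 b4 st0) ∧ goodY (leaf b1 b2 b4 st1) := by
  decide +kernel

lemma leaf_ty0 : ∀ b1 b2 b4 : Bool, ty (fun i => (leaf b1 b2 b4 st0 i).1)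
    = if b2 then (if b4 then 2 else 1) else (if b4 then 1 else 0) := by
  decide +kernel

lemma leaf_ty1 : ∀ b1 b2 b4 : Bool, ty (fun i => (leaf b1 b2 b4 st1 i).1)
    = if b4 || (b1 && b2) then 3 else 1 := by
  decide +kernel

lemma EV_V3 (K : (Fin 4 → Slot) → ℝ) (q p r : ℝ) (y : Fin 4 → Slot) :
    EV (V3' q p r) K y =
      q * (p * (r * K (leaf true true true y) + (1 - r) * K (leaf true true false y))
        + (1 - p) * (r * K (leaf true false true y) + (1 - r) * K (leaf true false false y)))
      + (1 - q) * (p * (r * K (leaf false true true y) + (1 - r) * K (leaf false true false y))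
        + (1 - p) * (r * K (leaf false false true y) + (1 - r) * K (leaf false false false y))) := by
  simp only [V3', EV, leaf, if_true, one_smul, Bool.false_eq_true, if_false]
  ring

lemma V3_eval0 (K : (Fin 4 → Slot) → ℝ) (a : Fin 4 → ℝ)
    (hK : ∀ y, goodY y → K y = a (ty (fun i => (y i).1))) (q p r : ℝ) :
    EV (V3' q p r) K st0 = (1 - p) * (1 - r) * a 0 + p * r * a 2
      + (p * (1 - r) + (1 - p) * r) * a 1 := by
  have h := fun b1 b2 b4 => hK _ (leaf_good b1 b2 b4).1
  simp only [leaf_ty0] at h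
  rw [EV_V3]
  simp only [h, if_true, Bool.false_eq_true, if_false]
  ring

lemma V3_eval1 (K : (Fin 4 → Slot) → ℝ) (a : Fin 4 → ℝ)
    (hK : ∀ y, goodY y → K y = a (ty (fun i => (y i).1))) (q p r : ℝ) :
    EV (V3' q p r) K st1 = (r + q * p * (1 - r)) * a 3 + (1 - (r + q * p * (1 - r))) * a 1 := by
  have h := fun b1 b2 b4 => hK _ (leaf_good b1 b2 b4).2
  simp only [leaf_ty1] at h
  rw [EV_V3]
  simp only [h, Bool.or_true, Bool.true_or, Bool.and_true, Bool.and_false, Bool.false_and, Bool.or_false,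
    Bool.true_and, Bool.false_or, if_true, Bool.false_eq_true, if_false]
  ring

variable {k : ℕ}

/-- inclusion of the slots -/
def slotE (h4 : 4 ≤ k) : Slot ↪ Fin 3 × Fin k :=
  ⟨fun x => (x.1, Fin.castLE h4 x.2), fun x y h => by
    simp only [Prod.mk.injEq] at h
    exact Prod.ext h.1 (Fin.castLE_injective h4 h.2)⟩

lemma slotE_apply (h4 : 4 ≤ k) (x : Slot) : slotE h4 x = (x.1, Fin.castLE h4 x.2) := rfl

lemma EV_slot (h4 : 4 ≤ k) (L : List (Slot × Slot × ℝ)) (H : (Fin 4 → Fin 3 × Fin k) → ℝ)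
    (y : Fin 4 → Slot) :
    EV (lmap (slotE h4) L) H (fun i => slotE h4 (y i))
      = EV L (fun y => H (fun i => slotE h4 (y i))) y := by
  have l1 := EV_lift (Equiv.Perm.viaEmbeddingHom (slotE h4)) (slotE h4) (via_swap (slotE h4)) L H
    (fun i => slotE h4 (y i)) 1
  rw [map_one, one_smul] at l1
  unfold lmap
  rw [l1]
  refine EV_congr _ _ _ _ _ (fun ρ => ?_)
  congr 1
  funext i
  simp only [Pi.smul_apply, Perm.smul_def, smul_eq_mul, mul_one, Equiv.Perm.viaEmbeddingHom_apply]
  exact Equiv.Perm.viaEmbedding_apply ρ (slotE h4) (y i)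

lemma sum_perm_apply [NeZero k] (f : Fin k → ℝ) :
    (1 / (k.factorial : ℝ)) * ∑ γ : Perm (Fin k), f (γ 0) = (1 / (k:ℝ)) * ∑ j, f j := by
  classical
  have := inj_avg (fun u : Fin 1 → Fin k => f (u 0)) (fun _ => 0)
    (Function.injective_of_subsingleton _)
  have e : ∑ c ∈ Finset.univ.filter (fun c : Fin 1 → Fin k => Function.Injective c), f (c 0)
      = ∑ j, f j := by
    rw [Finset.filter_true_of_mem (fun c _ => Function.injective_of_subsingleton _)]
    exact Fintype.sum_equiv (Equiv.funUnique (Fin 1) (Fin k)) _ _ (fun c => rfl)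
  rw [e] at this
  simp only [Fintype.card_fin, Nat.descFactorial_one] at this
  have h1 : (k.factorial : ℝ) ≠ 0 := by positivity
  have h2 : (k : ℝ) ≠ 0 := by exact_mod_cast NeZero.ne k
  field_simp
  linarith

/-- spreading phase -/
noncomputable def V2 (k : ℕ) [NeZero k] (s : ℝ) : List ((Fin 3 × Fin k) × (Fin 3 × Fin k) × ℝ) :=
  spread (0, 0) ((List.finRange k).map (fun j => (2, j))) (s / k)

lemma V2_eval [NeZero k] (h4 : 4 ≤ k) (s : ℝ) (hs0 : 0 ≤ s) (hs1 : s ≤ 1)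
    (G : (Fin 4 → Fin 3 × Fin k) → ℝ) :
    EV (V2 k s) G (fun i => slotE h4 (st0 i))
      = (1 - s) * ((1 / (k.factorial : ℝ)) *
          ∑ γ : Perm (Fin k), G (rowAct 2 γ • (fun i => slotE h4 (st0 i))))
        + s * ((1 / (k.factorial : ℝ)) *
          ∑ γ : Perm (Fin k), G (rowAct 2 γ • (fun i => slotE h4 (st1 i)))) := by
  have hk : (k:ℝ) ≠ 0 := by exact_mod_cast NeZero.ne k
  have hk' : (0:ℝ) ≤ k := by positivity
  have hf : (k.factorial : ℝ) ≠ 0 := by positivity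
  have hz : Fin.castLE h4 0 = (0 : Fin k) := Fin.ext (by simp)
  have hz' : ∀ i : Fin 4, Fin.castLE h4 i = (0 : Fin k) ↔ i = 0 := by
    intro i; rw [← hz]; exact (Fin.castLE_injective h4).eq_iff
  have e0 : ∀ γ : Perm (Fin k), rowAct 2 γ • (fun i => slotE h4 (st0 i))
      = (fun i => slotE h4 (st0 i)) := by
    intro γ; funext i
    simp [rowAct_apply, slotE_apply, st0]
  have es : ∀ j : Fin k, swap ((0 : Fin 3), (0 : Fin k)) (2, j) • (fun i => slotE h4 (st0 i))
      = fun i => if i = 0 then (2, j) else slotE h4 (st0 i) := by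
    intro j; funext i
    simp only [Pi.smul_apply, Perm.smul_def, slotE_apply, st0, swap_apply_def, Prod.mk.injEq, true_and, hz']
    split_ifs <;> simp_all
  have e1 : ∀ γ : Perm (Fin k), rowAct 2 γ • (fun i => slotE h4 (st1 i))
      = swap ((0 : Fin 3), (0 : Fin k)) (2, γ 0) • (fun i => slotE h4 (st0 i)) := by
    intro γ; rw [es]; funext i
    have : st1 i = if i = 0 then (2, 0) else (0, i) := by
      revert i; decide
    simp only [Pi.smul_apply, Perm.smul_def, rowAct_apply, this]
    split_ifs with h1 h2 <;> simp_all [slotE_apply, st0]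
  simp only [e0, e1]
  rw [sum_perm_apply (fun j => G (swap ((0 : Fin 3), (0 : Fin k)) (2, j) • (fun i => slotE h4 (st0 i))))]
  unfold V2
  rw [spread_eval]
  · rw [List.map_map]
    have : ((List.finRange k).map ((fun c => G (swap ((0 : Fin 3), (0 : Fin k)) c •
        (fun i => slotE h4 (st0 i)))) ∘ (fun j => ((2 : Fin 3), j)))).sum
        = ∑ j, G (swap ((0 : Fin 3), (0 : Fin k)) (2, j) • (fun i => slotE h4 (st0 i))) := by
      rw [← List.sum_ofFn, List.ofFn_eq_map]; rfl
    rw [this]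
    simp only [List.length_map, List.length_finRange, Finset.sum_const, Finset.card_univ,
      Fintype.card_perm, Fintype.card_fin, nsmul_eq_mul]
    field_simp
  · exact (List.nodup_finRange k).map (fun a b h => by simpa using h)
  · positivity
  · simp only [List.length_map, List.length_finRange]
    rw [mul_div_cancel₀ _ hk]; exact hs1
  · intro c hc c' hc' hcc
    simp only [List.mem_map, List.mem_finRange, true_and] at hc hc'
    obtain ⟨j, rfl⟩ := hc
    obtain ⟨j', rfl⟩ := hc'
    rw [es]
    funext i
    simp only [Pi.smul_apply, Perm.smul_def]
    split_ifs with h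
    · exact swap_apply_of_ne_of_ne (by simp) hcc
    · exact swap_apply_of_ne_of_ne (by simp [slotE_apply, st0, hz', h]) (by simp [slotE_apply, st0])

end Program

section Main

lemma perm_shuffle (d : ℕ) (c : Fin (d + 1)) : ∃ L : List (Fin (d + 1) × Fin (d + 1) × ℝ),
    Sh L (fun i : Fin (d + 1) => i) ∧ (∀ e ∈ L, VV e ∧ e.1 = c) ∧ L.length = d * (d + 1) / 2 := by
  obtain ⟨s, L, hs, hL, hv, hl⟩ := naive d 0
  have hb : Function.Bijective s := by
    rw [Fintype.bijective_iff_injective_and_card]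
    exact ⟨hs, by simp⟩
  let e0 : Fin (0 + d + 1) ≃ Fin (d + 1) := (Equiv.ofBijective s hb).symm
  have he0 : ∀ i, e0 (s i) = i := fun i => (Equiv.ofBijective s hb).symm_apply_apply i
  let e : Fin (0 + d + 1) ≃ Fin (d + 1) := e0.trans (swap 0 c)
  refine ⟨lmap e L, ?_, ?_, ?_⟩
  · have := sh_transport e (swap 0 c) L s hL
    have h2 : (fun i => e (s (swap 0 c i))) = fun i : Fin (d + 1) => i := by
      funext i
      simp [e, he0]
    rw [h2] at this
    exact this
  · have := lmap_valid e e.injective L (s 0) hv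
    have h2 : e (s 0) = c := by simp [e, he0]
    rwa [h2] at this
  · rw [lmap_length, hl]; simp

variable {k : ℕ}

lemma V1_eval (h4 : 4 ≤ k) (L44 : List (Fin 4 × Fin 4 × ℝ)) (hL : Sh L44 (fun i : Fin 4 => i))
    (G : (Fin 4 → Fin 3 × Fin k) → ℝ) :
    EV (lmap (slotE h4) (lmap (rowE 0) L44)) G (fun i => slotE h4 (st0 i))
      = (1 / 24 : ℝ) * ∑ σ : Perm (Fin 4), G (fun i => slotE h4 (st0 (σ i))) := by
  rw [EV_slot, row_eval (le_refl 4) L44 hL _ 0]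
  · have h24 : ((Nat.factorial 4 : ℕ) : ℝ) = 24 := by norm_num [Nat.factorial]
    rw [h24]
    congr 1
    refine Finset.sum_congr rfl (fun α _ => ?_)
    congr 1
    funext i
    simp [rowAct_apply, st0]
  · intro i _; exact (st0 i).2.isLt

/-- The average phase value for slots. -/
lemma Kval (h4 : 4 ≤ k) (h2 : 2 ≤ k) (LA LB : List (LazyT k)) (hA : Sh LA (Fin.castLE h4))
    (hB : Sh LB (Fin.castLE h2)) {Φ : (Fin 4 → Fin 3 × Fin k) → ℝ} (hΦ : ColInv Φ)
    (y : Fin 4 → Slot) (hy : goodY y) :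
    (1 / (k.factorial : ℝ)) * ∑ γ : Perm (Fin k), (1 / 24 : ℝ) * ∑ σ : Perm (Fin 4),
      EV (lmap (rowE 0) LA ++ lmap (rowE 1) LB) Φ
        (fun i => (rowAct 2 γ • (fun i => slotE h4 (y i))) (σ i))
      = aa Φ (ty (fun i => (y i).1)) := by
  rw [← aa_eq hΦ, ← Finset.mul_sum, Finset.sum_comm, mul_left_comm, Finset.mul_sum]
  congr 1
  refine Finset.sum_congr rfl (fun σ _ => ?_)
  have := rows_eval h4 h2 LA LB hA hB Φ (fun i => slotE h4 (y (σ i)))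
    (fun i j h => σ.injective (hy.1 ((slotE h4).injective h)))
    (fun i _ => (y (σ i)).2.isLt) (fun i hi => hy.2 (σ i) hi)
  exact this

lemma V3_comm (h4 : 4 ≤ k) (q p r : ℝ) (γ : Perm (Fin k)) :
    ∀ e ∈ lmap (slotE h4) (V3' q p r),
      swap e.1 e.2.1 * rowAct 2 γ = rowAct 2 γ * swap e.1 e.2.1 := by
  intro e he
  have h : e.1.1 ≠ 2 ∧ e.2.1.1 ≠ 2 := by
    simp only [lmap, V3', List.map_cons, List.map_nil, List.mem_cons, List.not_mem_nil, or_false] at he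
    rcases he with rfl | rfl | rfl | rfl <;> simp [slotE_apply]
  have h1 : rowAct 2 γ e.1 = e.1 := by rw [rowAct_apply, if_neg h.1]
  have h2 : rowAct 2 γ e.2.1 = e.2.1 := by rw [rowAct_apply, if_neg h.2]
  have := Equiv.mul_swap_eq_swap_mul (rowAct 2 γ) e.1 e.2.1
  rw [h1, h2] at this
  exact this.symm

lemma V3_avg (h4 : 4 ≤ k) (q p r : ℝ) (Hb : (Fin 4 → Fin 3 × Fin k) → ℝ) (y : Fin 4 → Slot) :
    (1 / (k.factorial : ℝ)) * ∑ γ : Perm (Fin k),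
      EV (lmap (slotE h4) (V3' q p r)) Hb (rowAct 2 γ • (fun i => slotE h4 (y i)))
      = EV (V3' q p r) (fun y => (1 / (k.factorial : ℝ)) * ∑ γ : Perm (Fin k),
        Hb (rowAct 2 γ • (fun i => slotE h4 (y i)))) y := by
  generalize hW : V3' q p r = W
  have hc : ∀ γ : Perm (Fin k), ∀ e ∈ lmap (slotE h4) W,
      swap e.1 e.2.1 * rowAct 2 γ = rowAct 2 γ * swap e.1 e.2.1 := by
    rw [← hW]; exact V3_comm h4 q p r
  rw [EV_mul W (1 / (k.factorial : ℝ))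
    (fun y : Fin 4 → Slot => ∑ γ : Perm (Fin k), Hb (rowAct 2 γ • (fun i => slotE h4 (y i)))), EV_sum]
  congr 1
  refine Finset.sum_congr rfl (fun γ _ => ?_)
  rw [EV_comm _ Hb _ _ (hc γ), EV_slot h4 W]

/-- the first three phases -/
noncomputable def front (h4 : 4 ≤ k) [NeZero k] (L44 : List (Fin 4 × Fin 4 × ℝ)) (s q p r : ℝ) :
    List ((Fin 3 × Fin k) × (Fin 3 × Fin k) × ℝ) :=
  lmap (slotE h4) (lmap (rowE 0) L44) ++ (V2 k s ++ lmap (slotE h4) (V3' q p r))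

lemma front_eval [NeZero k] (h4 : 4 ≤ k) (L44 : List (Fin 4 × Fin 4 × ℝ))
    (hL : Sh L44 (fun i : Fin 4 => i)) (s q p r : ℝ) (hs0 : 0 ≤ s) (hs1 : s ≤ 1)
    (H : (Fin 4 → Fin 3 × Fin k) → ℝ) (a : Fin 4 → ℝ)
    (hH : ∀ y, goodY y → (1 / (k.factorial : ℝ)) * ∑ γ : Perm (Fin k), (1 / 24 : ℝ) *
      ∑ σ : Perm (Fin 4), H (fun i => (rowAct 2 γ • (fun i => slotE h4 (y i))) (σ i))
        = a (ty (fun i => (y i).1))) :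
    EV (front h4 L44 s q p r) H (fun i => slotE h4 (st0 i))
      = (1 - s) * ((1 - p) * (1 - r) * a 0 + p * r * a 2 + (p * (1 - r) + (1 - p) * r) * a 1)
        + s * ((r + q * p * (1 - r)) * a 3 + (1 - (r + q * p * (1 - r))) * a 1) := by
  unfold front
  rw [EV_append, V1_eval h4 L44 hL]
  set V23 := V2 k s ++ lmap (slotE h4) (V3' q p r) with hV23
  have e1 : (1 / 24 : ℝ) * ∑ σ : Perm (Fin 4), EV V23 H (fun i => slotE h4 (st0 (σ i)))
      = EV V23 (fun y => (1 / 24 : ℝ) * ∑ σ : Perm (Fin 4), H (fun i => y (σ i)))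
        (fun i => slotE h4 (st0 i)) := by
    rw [EV_mul V23 (1 / 24) (fun y : Fin 4 → Fin 3 × Fin k =>
      ∑ σ : Perm (Fin 4), H (fun i => y (σ i))), EV_sum]
    congr 1
    exact Finset.sum_congr rfl (fun σ _ => EV_pre V23 H (fun i => slotE h4 (st0 i)) σ)
  rw [e1, hV23, EV_append, V2_eval h4 s hs0 hs1]
  have e2 : ∀ y : Fin 4 → Slot, (1 / (k.factorial : ℝ)) * ∑ γ : Perm (Fin k),
      EV (lmap (slotE h4) (V3' q p r))
        (fun y => (1 / 24 : ℝ) * ∑ σ : Perm (Fin 4), H (fun i => y (σ i)))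
        (rowAct 2 γ • (fun i => slotE h4 (y i)))
      = EV (V3' q p r) (fun y => (1 / (k.factorial : ℝ)) * ∑ γ : Perm (Fin k), (1 / 24 : ℝ) *
      ∑ σ : Perm (Fin 4), H (fun i => (rowAct 2 γ • (fun i => slotE h4 (y i))) (σ i))) y := by
    intro y
    exact V3_avg h4 q p r _ y
  rw [e2, e2, V3_eval0 _ a hH, V3_eval1 _ a hH]

end Main

section Final

variable {k : ℕ}

/-- parameter -/
noncomputable def pp (x : ℝ) : ℝ := 3 * x / (4 * x - 3)
/-- parameter -/
noncomputable def rr (x : ℝ) : ℝ := 2 * (x - 1) / (3 * x - 4)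
/-- parameter -/
noncomputable def ss (x : ℝ) : ℝ := (15 * x ^ 2 - 2 * x - 6) / (3 * ((3 * x - 1) * (3 * x - 2)))
/-- parameter -/
noncomputable def qq (x : ℝ) : ℝ := (4 * x - 3) * (6 * x ^ 3 - 14 * x ^ 2 + 8 * x - 12) /
  (3 * x * (x - 2) * (15 * x ^ 2 - 2 * x - 6))

lemma pp_mem (x : ℝ) (hx : 4 ≤ x) : 0 ≤ pp x ∧ pp x ≤ 1 := by
  have h : 0 < 4 * x - 3 := by linarith
  unfold pp
  exact ⟨div_nonneg (by linarith) h.le, by rw [div_le_one h]; linarith⟩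

lemma rr_mem (x : ℝ) (hx : 4 ≤ x) : 0 ≤ rr x ∧ rr x ≤ 1 := by
  have h : 0 < 3 * x - 4 := by linarith
  unfold rr
  exact ⟨div_nonneg (by linarith) h.le, by rw [div_le_one h]; linarith⟩

lemma ss_mem (x : ℝ) (hx : 4 ≤ x) : 0 ≤ ss x ∧ ss x ≤ 1 := by
  have h : 0 < 3 * ((3 * x - 1) * (3 * x - 2)) := by
    have : 0 < 3 * x - 1 := by linarith
    have : 0 < 3 * x - 2 := by linarith
    positivity
  unfold ss
  exact ⟨div_nonneg (by nlinarith) h.le, by rw [div_le_one h]; nlinarith⟩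

lemma qq_mem (x : ℝ) (hx : 4 ≤ x) : 0 ≤ qq x ∧ qq x ≤ 1 := by
  obtain ⟨u, rfl⟩ : ∃ u, x = u + 4 := ⟨x - 4, by ring⟩
  have hu : 0 ≤ u := by linarith
  have e1 : 4 * (u + 4) - 3 = 4 * u + 13 := by ring
  have e2 : 6 * (u + 4) ^ 3 - 14 * (u + 4) ^ 2 + 8 * (u + 4) - 12
    = 6 * u ^ 3 + 58 * u ^ 2 + 184 * u + 180 := by ring
  have e3 : 15 * (u + 4) ^ 2 - 2 * (u + 4) - 6 = 15 * u ^ 2 + 118 * u + 226 := by ring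
  have e4 : u + 4 - 2 = u + 2 := by ring
  unfold qq
  rw [e1, e2, e3, e4]
  have h : 0 < 3 * (u + 4) * (u + 2) * (15 * u ^ 2 + 118 * u + 226) := by positivity
  refine ⟨by positivity, ?_⟩
  rw [div_le_one h]
  have : 0 ≤ 3 * (u + 4) * (u + 2) * (15 * u ^ 2 + 118 * u + 226)
      - (4 * u + 13) * (6 * u ^ 3 + 58 * u ^ 2 + 184 * u + 180) := by
    ring_nf
    positivity
  linarith

lemma den_ne (x : ℝ) (hx : 4 ≤ x) : 3 * ((3 * x - 1) * (3 * x - 2)) ≠ 0 := by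
  have h3 : 3 * x - 1 ≠ 0 := by linarith
  have h4 : 3 * x - 2 ≠ 0 := by linarith
  exact mul_ne_zero (by norm_num) (mul_ne_zero h3 h4)

lemma den_ne' (x : ℝ) (hx : 4 ≤ x) : 3 * x * (3 * x - 1) * (3 * x - 2) * (3 * x - 3) ≠ 0 := by
  have h3 : 3 * x - 1 ≠ 0 := by linarith
  have h4 : 3 * x - 2 ≠ 0 := by linarith
  have h5 : 3 * x - 3 ≠ 0 := by linarith
  have h6 : 3 * x ≠ 0 := by linarith
  exact mul_ne_zero (mul_ne_zero (mul_ne_zero h6 h3) h4) h5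

lemma one_sub_pp (x : ℝ) (hx : 4 ≤ x) : 1 - pp x = (x - 3) / (4 * x - 3) := by
  have h : 4 * x - 3 ≠ 0 := by linarith
  unfold pp
  rw [eq_div_iff h, sub_mul, div_mul_cancel₀ _ h]; ring

lemma one_sub_rr (x : ℝ) (hx : 4 ≤ x) : 1 - rr x = (x - 2) / (3 * x - 4) := by
  have h : 3 * x - 4 ≠ 0 := by linarith
  unfold rr
  rw [eq_div_iff h, sub_mul, div_mul_cancel₀ _ h]; ring

lemma one_sub_ss (x : ℝ) (hx : 4 ≤ x) :
    1 - ss x = ((4 * x - 3) * (3 * x - 4)) / (3 * ((3 * x - 1) * (3 * x - 2))) := by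
  have h := den_ne x hx
  unfold ss
  rw [eq_div_iff h, sub_mul, div_mul_cancel₀ _ h]; ring

lemma w0 (x : ℝ) (hx : 4 ≤ x) : (1 - ss x) * ((1 - pp x) * (1 - rr x))
    = 3 * (x * (x - 1) * (x - 2) * (x - 3)) / (3 * x * (3 * x - 1) * (3 * x - 2) * (3 * x - 3)) := by
  have h1 : 4 * x - 3 ≠ 0 := by linarith
  have h2 : 3 * x - 4 ≠ 0 := by linarith
  rw [one_sub_pp x hx, one_sub_rr x hx, one_sub_ss x hx, div_mul_div_comm, div_mul_div_comm,
    div_eq_div_iff (mul_ne_zero (den_ne x hx) (mul_ne_zero h1 h2)) (den_ne' x hx)]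
  ring

lemma w2 (x : ℝ) (hx : 4 ≤ x) : (1 - ss x) * (pp x * rr x)
    = 18 * (x * (x - 1)) ^ 2 / (3 * x * (3 * x - 1) * (3 * x - 2) * (3 * x - 3)) := by
  have h1 : 4 * x - 3 ≠ 0 := by linarith
  have h2 : 3 * x - 4 ≠ 0 := by linarith
  rw [one_sub_ss x hx, pp, rr, div_mul_div_comm, div_mul_div_comm,
    div_eq_div_iff (mul_ne_zero (den_ne x hx) (mul_ne_zero h1 h2)) (den_ne' x hx)]
  ring

lemma w3 (x : ℝ) (hx : 4 ≤ x) : ss x * (rr x + qq x * pp x * (1 - rr x))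
    = 36 * (x ^ 2 * (x * (x - 1))) / (3 * x * (3 * x - 1) * (3 * x - 2) * (3 * x - 3)) := by
  have h1 : 4 * x - 3 ≠ 0 := by linarith
  have h2 : 3 * x - 4 ≠ 0 := by linarith
  have h6 : 3 * x ≠ 0 := by linarith
  have h7 : x - 2 ≠ 0 := by linarith
  have h8 : 15 * x ^ 2 - 2 * x - 6 ≠ 0 := by nlinarith
  have h9 : 3 * x * (x - 2) * (15 * x ^ 2 - 2 * x - 6) ≠ 0 :=
    mul_ne_zero (mul_ne_zero h6 h7) h8
  rw [one_sub_rr x hx, ss, pp, qq, rr, div_mul_div_comm, div_mul_div_comm,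
    div_add_div _ _ h2 (mul_ne_zero (mul_ne_zero h9 h1) h2), div_mul_div_comm,
    div_eq_div_iff (mul_ne_zero (den_ne x hx) (mul_ne_zero h2 (mul_ne_zero (mul_ne_zero h9 h1) h2)))
      (den_ne' x hx)]
  ring

lemma w_total (x : ℝ) (hx : 4 ≤ x) (a0 a1 a2 a3 : ℝ) :
    (1 - ss x) * ((1 - pp x) * (1 - rr x) * a0 + pp x * rr x * a2
        + (pp x * (1 - rr x) + (1 - pp x) * rr x) * a1)
      + ss x * ((rr x + qq x * pp x * (1 - rr x)) * a3 + (1 - (rr x + qq x * pp x * (1 - rr x))) * a1)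
    = (1 / (3 * x * (3 * x - 1) * (3 * x - 2) * (3 * x - 3))) *
      (3 * (x * (x - 1) * (x - 2) * (x - 3)) * a0 + 24 * (x * (x * (x - 1) * (x - 2))) * a1
        + 18 * (x * (x - 1)) ^ 2 * a2 + 36 * (x ^ 2 * (x * (x - 1))) * a3) := by
  have e0 := w0 x hx
  have e2 := w2 x hx
  have e3 := w3 x hx
  have e1 : 1 - (1 - ss x) * ((1 - pp x) * (1 - rr x)) - (1 - ss x) * (pp x * rr x)
      - ss x * (rr x + qq x * pp x * (1 - rr x))
      = 24 * (x * (x * (x - 1) * (x - 2))) / (3 * x * (3 * x - 1) * (3 * x - 2) * (3 * x - 3)) := by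
    rw [e0, e2, e3, sub_sub, sub_sub, ← add_div, ← add_div, eq_div_iff (den_ne' x hx), sub_mul,
      div_mul_cancel₀ _ (den_ne' x hx)]
    ring
  have key : (1 - ss x) * ((1 - pp x) * (1 - rr x) * a0 + pp x * rr x * a2
        + (pp x * (1 - rr x) + (1 - pp x) * rr x) * a1)
      + ss x * ((rr x + qq x * pp x * (1 - rr x)) * a3 + (1 - (rr x + qq x * pp x * (1 - rr x))) * a1)
      = ((1 - ss x) * ((1 - pp x) * (1 - rr x))) * a0 + ((1 - ss x) * (pp x * rr x)) * a2
        + (ss x * (rr x + qq x * pp x * (1 - rr x))) * a3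
        + (1 - (1 - ss x) * ((1 - pp x) * (1 - rr x)) - (1 - ss x) * (pp x * rr x)
      - ss x * (rr x + qq x * pp x * (1 - rr x))) * a1 := by ring
  rw [key, e1, e0, e2, e3]
  ring

open Classical in
lemma core [NeZero k] (h4 : 4 ≤ k) (h2 : 2 ≤ k) (L44 : List (Fin 4 × Fin 4 × ℝ))
    (hL : Sh L44 (fun i : Fin 4 => i)) (LA LB : List (LazyT k)) (hA : Sh LA (Fin.castLE h4))
    (hB : Sh LB (Fin.castLE h2)) (L3 : List (Fin 3 × Fin 3 × ℝ)) (h3 : Sh L3 (fun i : Fin 3 => i))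
    (F : (Fin 4 → Fin 3 × Fin k) → ℝ) :
    EV (front h4 L44 (ss k) (qq k) (pp k) (rr k) ++ ((lmap (rowE 0) LA ++ lmap (rowE 1) LB) ++
      cols L3 (List.finRange k))) F (fun i => slotE h4 (st0 i))
      = (1 / ((3 * k).descFactorial 4 : ℝ)) *
        ∑ g ∈ Finset.univ.filter (fun g : Fin 4 → Fin 3 × Fin k => Function.Injective g), F g := by
  have hx : (4:ℝ) ≤ k := by exact_mod_cast h4
  have hΦ : ColInv (EV (cols L3 (List.finRange k)) F) := fun c ρ g =>
    cols_inv L3 (fun i => i) (fun i => ⟨i, rfl⟩) h3 F (List.finRange k) c (List.mem_finRange c) ρ g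
  have hsum : ∑ g ∈ Finset.univ.filter (fun g : Fin 4 → Fin 3 × Fin k => Function.Injective g), F g
      = 3 * NN k (can 0) * aa (EV (cols L3 (List.finRange k)) F) 0
        + 24 * NN k (can 1) * aa (EV (cols L3 (List.finRange k)) F) 1
        + 18 * NN k (can 2) * aa (EV (cols L3 (List.finRange k)) F) 2
        + 36 * NN k (can 3) * aa (EV (cols L3 (List.finRange k)) F) 3 := by
    rw [← sum_inj_eq h4 hΦ]
    convert (EV_sum_inj (cols L3 (List.finRange k)) F).symm
  rw [EV_append, hsum]
  rw [front_eval h4 L44 hL _ _ _ _ (ss_mem k hx).1 (ss_mem k hx).2 _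
    (aa (EV (cols L3 (List.finRange k)) F))]
  · rw [w_total k hx]
    have hd : ((3 * k).descFactorial 4 : ℝ) = 3 * k * (3 * k - 1) * (3 * k - 2) * (3 * k - 3) := by
      obtain ⟨m, rfl⟩ := Nat.exists_eq_add_of_le' h4
      have : 3 * (m + 4) = 3 * m + 8 + 4 := by ring
      rw [this]
      simp only [Nat.descFactorial, Nat.add_sub_cancel]
      have a1 : 3 * m + 8 + 4 - 1 = 3 * m + 11 := by omega
      have a2 : 3 * m + 8 + 4 - 2 = 3 * m + 10 := by omega
      have a3 : 3 * m + 8 + 4 - 3 = 3 * m + 9 := by omega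
      rw [a1, a2, a3]
      push_cast
      ring
    rw [hd, NN_val h4, NN_val h4, NN_val h4, NN_val h4]
    simp
  · intro y hy
    have := Kval h4 h2 LA LB hA hB hΦ y hy
    rw [← this]
    simp only [EV_append]

lemma Impl_cols {R ι : Type*} [DecidableEq R] {z : R} (L3 : List (Fin 3 × Fin 3 × ℝ))
    (h3 : ∀ e ∈ L3, VV e ∧ e.1 = 1) (hl : L3.length = 3) (c0 : Fin k) (cs : List (Fin k))
    (hn : (c0 :: cs).Nodup) :
    ∃ c', Impl ι z ((1 : Fin 3), c0) (cols L3 cs) c' (4 * cs.length) := by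
  induction cs generalizing c0 with
  | nil => exact ⟨_, Impl.nil _⟩
  | cons c cs ih =>
    have hc : c0 ≠ c := fun h => by simp [h] at hn
    obtain ⟨c', h⟩ := ih c (List.nodup_cons.mp hn).2
    have h1 : Impl ι z ((1 : Fin 3), c0) [] ((1 : Fin 3), c) 1 := Impl.move (by simpa using hc)
    have h2 : Impl ι z ((1 : Fin 3), c) (lmap (colE c) L3) ((1 : Fin 3), c) 3 := by
      have := Impl.star (ι := ι) (z := z) _ (lmap_valid (colE c) (colE c).injective L3 1 h3)
      rwa [lmap_length, hl] at this
    refine ⟨c', ?_⟩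
    have := h1.append (h2.append h)
    have e : 4 * (c :: cs).length = 1 + (3 + 4 * cs.length) := by simp; ring
    rw [e]
    exact this

lemma main_bound (h4 : 4 ≤ k) :
    Utstar 4 (3 * k) ≤ 5 * k + 10 + Utstar 2 k + Utstar 4 k := by
  classical
  have h2 : 2 ≤ k := by omega
  have : NeZero k := ⟨by omega⟩
  have hx : (4:ℝ) ≤ k := by exact_mod_cast h4
  obtain ⟨L44, hL44, hv44, hl44⟩ := perm_shuffle 3 0
  obtain ⟨L3, hL3, hv3, hl3⟩ := perm_shuffle 2 1
  obtain ⟨LA, hlA, hA, hsA⟩ : ∃ L : List (LazyT k), L.length = Utstar 4 k ∧ IsTShuffle h4 L ∧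
      ∀ e ∈ L, e.IsStar := by
    obtain ⟨m, rfl⟩ := Nat.exists_eq_add_of_le' h4
    exact Utstar_attained 3 m h4
  obtain ⟨LB, hlB, hB, hsB⟩ : ∃ L : List (LazyT k), L.length = Utstar 2 k ∧ IsTShuffle h2 L ∧
      ∀ e ∈ L, e.IsStar := by
    obtain ⟨m, rfl⟩ := Nat.exists_eq_add_of_le' h2
    exact Utstar_attained 1 m h2
  have hA' := (sh_iff h4 LA).1 hA.2
  have hB' := (sh_iff h2 LB).1 hB.2
  have vA : ∀ e ∈ LA, VV e ∧ e.1 = 0 := fun e he => ⟨hA.1 e he, Fin.ext ((show (e.1 : ℕ) = 0 from hsA e he).trans (by simp))⟩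
  have vB : ∀ e ∈ LB, VV e ∧ e.1 = 0 := fun e he => ⟨hB.1 e he, Fin.ext ((show (e.1 : ℕ) = 0 from hsB e he).trans (by simp))⟩
  set g0 : Fin 4 → Fin 3 × Fin k := fun i => slotE h4 (st0 i) with hg0
  have hginj : Function.Injective g0 := fun i j h => by
    have := (slotE h4).injective h
    simpa [st0] using this
  set V := front h4 L44 (ss k) (qq k) (pp k) (rr k) ++ ((lmap (rowE 0) LA ++ lmap (rowE 1) LB) ++
      cols L3 (List.finRange k)) with hV
  have hSh : Sh V g0 := by
    intro F hF
    obtain ⟨F', hF'⟩ := factor g0 F hF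
    have e1 : EV V F 1 = EV V F' g0 := by
      refine EV_congr V F F' 1 g0 (fun ρ => ?_)
      rw [smul_eq_mul, mul_one]
      exact hF' ρ
    have e2 := inj_avg F' g0 hginj
    simp only [← hF'] at e2
    rw [e1, hV, core h4 h2 L44 hL44 LA LB hA' hB' L3 hL3 F']
    simp only [Fintype.card_prod, Fintype.card_fin] at e2 ⊢
    have hd : ((3 * k).descFactorial 4 : ℝ) ≠ 0 := by
      have : (3 * k).descFactorial 4 ≠ 0 := by
        rw [Ne, Nat.descFactorial_eq_zero_iff_lt]; omega
      exact_mod_cast this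
    have hf : ((3 * k).factorial : ℝ) ≠ 0 := by positivity
    field_simp
    linarith
  have hz : g0 0 = (0, 0) := by
    simp only [hg0, slotE_apply, st0]
    exact Prod.ext rfl (Fin.ext (by simp))
  have hI : ∃ c', Impl (Fin 4) (⟨0, by omega⟩ : Fin (3 * k)) (g0 0) V c'
      ((6 + (k + 4)) + ((Utstar 4 k + (1 + Utstar 2 k)) + (4 * k - 1))) := by
    rw [hz]
    have hs00 : slotE h4 (0, 0) = ((0 : Fin 3), (0 : Fin k)) := by
      rw [slotE_apply]; exact Prod.ext rfl (Fin.ext (by simp))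
    have i1 : Impl (Fin 4) (⟨0, by omega⟩ : Fin (3 * k)) ((0 : Fin 3), (0 : Fin k))
        (lmap (slotE h4) (lmap (rowE 0) L44)) (0, 0) 6 := by
      have hv := lmap_valid (slotE h4) (slotE h4).injective _ _
        (lmap_valid (rowE (k := 4) 0) (rowE 0).injective L44 0 hv44)
      have : slotE h4 (rowE 0 0) = ((0 : Fin 3), (0 : Fin k)) := hs00
      rw [this] at hv
      have := Impl.star (ι := Fin 4) (z := (⟨0, by omega⟩ : Fin (3 * k))) _ hv
      rwa [lmap_length, lmap_length, hl44] at this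
    have i2 : Impl (Fin 4) (⟨0, by omega⟩ : Fin (3 * k)) ((0 : Fin 3), (0 : Fin k))
        (V2 k (ss k)) (0, 0) k := by
      have hv : ∀ e ∈ V2 k (ss k), VV e ∧ e.1 = ((0 : Fin 3), (0 : Fin k)) := by
        refine spread_valid _ _ _ (by simp) (div_nonneg (ss_mem k hx).1 (by linarith)) ?_
        simp only [List.length_map, List.length_finRange]
        rw [mul_div_cancel₀ _ (by linarith)]
        exact (ss_mem k hx).2
      have := Impl.star (ι := Fin 4) (z := (⟨0, by omega⟩ : Fin (3 * k))) _ hv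
      rwa [V2, spread_length, List.length_map, List.length_finRange] at this
    have i3 : Impl (Fin 4) (⟨0, by omega⟩ : Fin (3 * k)) ((0 : Fin 3), (0 : Fin k))
        (lmap (slotE h4) (V3' (qq k) (pp k) (rr k))) (0, 0) 4 := by
      have hv0 : ∀ e ∈ V3' (qq k) (pp k) (rr k), VV e ∧ e.1 = ((0, 0) : Slot) := by
        intro e he
        simp only [V3', List.mem_cons, List.not_mem_nil, or_false] at he
        rcases he with rfl | rfl | rfl | rfl
        · exact ⟨⟨by simp, (qq_mem k hx).1, (qq_mem k hx).2⟩, rfl⟩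
        · exact ⟨⟨by simp, (pp_mem k hx).1, (pp_mem k hx).2⟩, rfl⟩
        · exact ⟨⟨by decide, by norm_num, by norm_num⟩, rfl⟩
        · exact ⟨⟨by simp, (rr_mem k hx).1, (rr_mem k hx).2⟩, rfl⟩
      have hv := lmap_valid (slotE h4) (slotE h4).injective _ _ hv0
      rw [hs00] at hv
      have := Impl.star (ι := Fin 4) (z := (⟨0, by omega⟩ : Fin (3 * k))) _ hv
      rwa [lmap_length] at this
    have i4 : Impl (Fin 4) (⟨0, by omega⟩ : Fin (3 * k)) ((0 : Fin 3), (0 : Fin k))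
        (lmap (rowE 0) LA) (0, 0) (Utstar 4 k) := by
      have := Impl.star (ι := Fin 4) (z := (⟨0, by omega⟩ : Fin (3 * k))) _
        (lmap_valid (rowE 0) (rowE 0).injective LA 0 vA)
      rwa [lmap_length, hlA] at this
    have i5 : Impl (Fin 4) (⟨0, by omega⟩ : Fin (3 * k)) ((0 : Fin 3), (0 : Fin k))
        [] (1, 0) 1 := Impl.move (by simp)
    have i6 : Impl (Fin 4) (⟨0, by omega⟩ : Fin (3 * k)) ((1 : Fin 3), (0 : Fin k))
        (lmap (rowE 1) LB) (1, 0) (Utstar 2 k) := by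
      have := Impl.star (ι := Fin 4) (z := (⟨0, by omega⟩ : Fin (3 * k))) _
        (lmap_valid (rowE 1) (rowE 1).injective LB 0 vB)
      rwa [lmap_length, hlB] at this
    have hl3' : L3.length = 3 := by rw [hl3]
    have i7 : ∃ c', Impl (Fin 4) (⟨0, by omega⟩ : Fin (3 * k)) ((1 : Fin 3), (0 : Fin k))
        (cols L3 (List.finRange k)) c' (4 * k - 1) := by
      obtain ⟨c0, cs, hcs⟩ : ∃ c0 cs, List.finRange k = c0 :: cs :=
        List.exists_cons_of_ne_nil (by
          intro h
          have := congrArg List.length h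
          simp at this; omega)
      have hc0 : c0 = 0 := by
        have : (List.finRange k)[0]? = some c0 := by rw [hcs]; rfl
        rw [List.getElem?_eq_some_iff] at this
        obtain ⟨hh, this⟩ := this
        rw [← this]
        simp
      have hlen : cs.length + 1 = k := by
        have := congrArg List.length hcs
        simp at this; omega
      have hnd := List.nodup_finRange k
      rw [hcs] at hnd
      obtain ⟨c', h⟩ := Impl_cols (ι := Fin 4) (z := (⟨0, by omega⟩ : Fin (3 * k)))
        L3 hv3 hl3' c0 cs hnd
      have h1 := Impl.star (ι := Fin 4) (z := (⟨0, by omega⟩ : Fin (3 * k))) _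
        (lmap_valid (colE c0) (colE c0).injective L3 1 hv3)
      rw [lmap_length, hl3'] at h1
      have h2 := h1.append h
      rw [hcs, hc0.symm]
      refine ⟨c', ?_⟩
      have e : 4 * k - 1 = 3 + 4 * cs.length := by omega
      rw [e]
      exact h2
    obtain ⟨c', i7⟩ := i7
    exact ⟨c', (i1.append (i2.append i3)).append ((i4.append (i5.append i6)).append i7)⟩
  obtain ⟨c', hI⟩ := hI
  obtain ⟨L, hl, hT, hS⟩ := fin_of_impl (t := 3) (n := 3 * k) (by omega) (by simp) V g0 hginj hSh c' _ hI
  have := Utstar_le _ L hT hS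
  rw [hl] at this
  have h' : Utstar 4 (3 * k) ≤ 6 + (k + 4) + (Utstar 4 k + (1 + Utstar 2 k) + (4 * k - 1)) := this
  omega

end Final

theorem Utstar_four_three_groups :
    (∀ k : ℕ, 3 ≤ k → Utstar 4 (3 * k) ≤ 5 * k + 10 + Utstar 2 k + Utstar 4 k) ∧
    (∀ k : ℕ, 3 ≤ k → Utstar 4 (3 * k) ≤ 11 * k - 3) := by
  have h9 : Utstar 4 9 ≤ 26 := Utstar_naive 3 5
  have h23 := Utstar_two_three
  constructor
  · intro k hk
    rcases Nat.lt_or_ge k 4 with h | h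
    · obtain rfl : k = 3 := by omega
      have : Utstar 4 (3 * 3) ≤ 26 := h9
      omega
    · exact main_bound h
  · intro k hk
    rcases Nat.lt_or_ge k 4 with h | h
    · obtain rfl : k = 3 := by omega
      have : Utstar 4 (3 * 3) ≤ 26 := h9
      omega
    · have h1 := main_bound h
      obtain ⟨m, rfl⟩ := Nat.exists_eq_add_of_le' h
      have h2 : Utstar 2 (m + 4) ≤ (1 + 1) * (m + 2) + 1 * (1 + 1) / 2 := Utstar_naive 1 (m + 2)
      have h4 : Utstar 4 (m + 4) ≤ (3 + 1) * m + 3 * (3 + 1) / 2 := Utstar_naive 3 m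
      omega
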